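/- arXiv:1608.02794 — 2 statements merged into one kernel-verified Lean document; each statement's English description precedes it below -/
import Mathlib

section
/- Let Ω ⊂ ℝ^m be a bounded open set with smooth boundary and let t_0, t_1, t_2 be real numbers with 0 ≤ t_0 < t_1 < t_2. Let t_* ∈ (0,1) be the unique number with t_1 = t_* t_0 + (1 − t_*) t_2. Then there exists a constant c > 0, independent of S, such that for every bounded linear functional S : C̃^{t_0}(cl Ω) → ℝ, the restrictions of S to C̃^{t_1}(cl Ω) and to C̃^{t_2}(cl Ω) are bounded linear functionals and ‖S|_{C̃^{t_1}(cl Ω)}‖ ≤ c ‖S|_{C̃^{t_0}(cl Ω)}‖^{t_*} ‖S|_{C̃^{t_2}(cl Ω)}‖^{1 − t_*}, where ‖·‖ denotes the operator norm of a linear functional on the respective normed space. -/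
open Set

noncomputable section

/-- `Ω` has smooth boundary: near every boundary point, `Ω` is the sublevel set of a smooth
function with non-vanishing differential. -/
def HasSmoothBoundary {E : Type*} [NormedAddCommGroup E] [NormedSpace ℝ E] (Ω : Set E) : Prop :=
  ∀ x ∈ frontier Ω, ∃ (U : Set E) (φ : E → ℝ), IsOpen U ∧ x ∈ U ∧ ContDiff ℝ (⊤ : ℕ∞) φ ∧
    (∀ y ∈ U, fderiv ℝ φ y ≠ 0) ∧ Ω ∩ U = {y ∈ U | φ y < 0}

/-- `f` belongs to `C^t(s)`: it is `C^⌊t⌋` on `s`, with bounded derivatives of order `≤ ⌊t⌋`,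
and the order-`⌊t⌋` derivative is `(t - ⌊t⌋)`-Hölder continuous on `s`. -/
def MemCt {E : Type*} [NormedAddCommGroup E] [NormedSpace ℝ E]
    (t : ℝ) (s : Set E) (f : E → ℝ) : Prop :=
  ContDiffOn ℝ (⌊t⌋₊ : ℕ) f s ∧
  (∃ C : ℝ, ∀ i : ℕ, (i : ℝ) ≤ t → ∀ x ∈ s, ‖iteratedFDerivWithin ℝ i f s x‖ ≤ C) ∧
  (∃ C : ℝ, ∀ x ∈ s, ∀ y ∈ s,
    ‖iteratedFDerivWithin ℝ ⌊t⌋₊ f s x - iteratedFDerivWithin ℝ ⌊t⌋₊ f s y‖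
      ≤ C * ‖x - y‖ ^ (t - (⌊t⌋₊ : ℝ)))

/-- The `C^t` norm on a set `s`. -/
def ctNorm {E : Type*} [NormedAddCommGroup E] [NormedSpace ℝ E]
    (t : ℝ) (s : Set E) (f : E → ℝ) : ℝ :=
  max (sSup {r : ℝ | ∃ i : ℕ, (i : ℝ) ≤ t ∧ ∃ x ∈ s, r = ‖iteratedFDerivWithin ℝ i f s x‖})
      (sSup {r : ℝ | ∃ x ∈ s, ∃ y ∈ s, x ≠ y ∧
        r = ‖iteratedFDerivWithin ℝ ⌊t⌋₊ f s x - iteratedFDerivWithin ℝ ⌊t⌋₊ f s y‖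
              / ‖x - y‖ ^ (t - (⌊t⌋₊ : ℝ))})

/-- `f ∈ C̃^t(cl Ω)`: `f ∈ C^t(cl Ω)` and `f` vanishes on `∂Ω`. -/
def MemCtTilde {E : Type*} [NormedAddCommGroup E] [NormedSpace ℝ E]
    (t : ℝ) (Ω : Set E) (f : E → ℝ) : Prop :=
  MemCt t (closure Ω) f ∧ ∀ x ∈ frontier Ω, f x = 0

/-- The K-functional `K(s, f; C̃^{t₀}(cl Ω), C̃^{t₁}(cl Ω))`. -/
def kFunctional {E : Type*} [NormedAddCommGroup E] [NormedSpace ℝ E]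
    (s : ℝ) (t₀ t₁ : ℝ) (Ω : Set E) (f : E → ℝ) : ℝ :=
  sInf {r : ℝ | ∃ f₀ f₁ : E → ℝ, (∀ x ∈ closure Ω, f x = f₀ x + f₁ x) ∧
    MemCtTilde t₀ Ω f₀ ∧ MemCtTilde t₁ Ω f₁ ∧
    r = ctNorm t₀ (closure Ω) f₀ + s * ctNorm t₁ (closure Ω) f₁}


/-- Operator norm of a linear functional `S` on `C̃^t(cl Ω)`: the least constant `C ≥ 0` with
`|S f| ≤ C ‖f‖_{C^t}` for all `f ∈ C̃^t(cl Ω)`. -/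
def dualNorm {E : Type*} [NormedAddCommGroup E] [NormedSpace ℝ E]
    (t : ℝ) (Ω : Set E) (S : (E → ℝ) → ℝ) : ℝ :=
  sInf {C : ℝ | 0 ≤ C ∧ ∀ f : E → ℝ, MemCtTilde t Ω f → |S f| ≤ C * ctNorm t (closure Ω) f}

section HolderInterpolation

open Filter Topology Metric
open scoped ContDiff

section Symmetry

variable {E : Type} [NormedAddCommGroup E] [NormedSpace ℝ E]

/-- Iterated derivatives of `C^n` maps are symmetric under adjacent transpositions. -/
lemma iteratedFDeriv_comp_swap_adjacent (n : ℕ) :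
    ∀ {F : Type} [NormedAddCommGroup F] [NormedSpace ℝ F] {f : E → F} {x : E},
      ContDiffAt ℝ (n + 1 : ℕ) f x → ∀ (i : Fin n) (v : Fin (n + 1) → E),
        iteratedFDeriv ℝ (n + 1) f x (v ∘ Equiv.swap i.castSucc i.succ)
          = iteratedFDeriv ℝ (n + 1) f x v := by
  induction n with
  | zero => intro F _ _ f x _ i; exact i.elim0
  | succ n ih =>
    intro F _ _ f x hf i v
    refine Fin.cases ?_ (fun j => ?_) i
    · rcases n with _ | n
      · have hs : IsSymmSndFDerivAt ℝ f x := hf.isSymmSndFDerivAt (by simp)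
        rw [iteratedFDeriv_two_apply, iteratedFDeriv_two_apply]
        have := hs.eq (v 1) (v 0)
        simpa using this
      · rw [iteratedFDeriv_succ_apply_right v, iteratedFDeriv_succ_apply_right (v ∘ _)]
        have hf'' : ContDiffAt ℝ (n + 1 + 1 : ℕ) (fderiv ℝ f) x :=
          hf.fderiv_right (by norm_cast)
        have key := ih (F := E →L[ℝ] F) hf'' 0 (Fin.init v)
        have e1 : Fin.init (v ∘ Equiv.swap (Fin.castSucc (0 : Fin (n + 2))) (Fin.succ 0))
            = Fin.init v ∘ Equiv.swap (Fin.castSucc (0 : Fin (n + 1))) (Fin.succ 0) := by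
          funext a
          simp only [Fin.init, Function.comp_apply]
          congr 1
          simp only [Equiv.swap_apply_def, Fin.ext_iff]
          split_ifs <;> simp_all
        have e2 : (v ∘ Equiv.swap (Fin.castSucc (0 : Fin (n + 2))) (Fin.succ 0))
            (Fin.last (n + 2)) = v (Fin.last _) := by
          simp only [Function.comp_apply]
          congr 1
        rw [e1, e2]
        exact congrArg (fun T => T (v (Fin.last _))) key
    · have hd : DifferentiableAt ℝ (iteratedFDeriv ℝ (n + 1) f) x :=
        hf.differentiableAt_iteratedFDeriv (by norm_cast; omega)
      rw [hd.iteratedFDeriv_succ_apply_left', hd.iteratedFDeriv_succ_apply_left']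
      have e1 : Fin.tail (v ∘ Equiv.swap j.succ.castSucc j.succ.succ)
          = Fin.tail v ∘ Equiv.swap j.castSucc j.succ := by
        funext a
        simp only [Fin.tail, Function.comp_apply]
        congr 1
        simp only [Equiv.swap_apply_def]
        split_ifs <;> simp_all [Fin.ext_iff]
      have e2 : (v ∘ Equiv.swap j.succ.castSucc j.succ.succ) 0 = v 0 := by
        simp only [Function.comp_apply]
        congr 1
      rw [e1, e2]
      have hev : (fun y => iteratedFDeriv ℝ (n + 1) f y
            (Fin.tail v ∘ Equiv.swap j.castSucc j.succ))
          =ᶠ[𝓝 x] fun y => iteratedFDeriv ℝ (n + 1) f y (Fin.tail v) := by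
        have hlow : ContDiffAt ℝ (n + 1 : ℕ) f x := hf.of_le (by norm_cast; omega)
        filter_upwards [hlow.eventually (by simp)] with y hy
        exact ih hy j _
      rw [hev.fderiv_eq]

/-- The `n`-th iterated derivative of a `C^n` map is symmetric. -/
theorem ContDiffAt.iteratedFDeriv_perm {F : Type} [NormedAddCommGroup F] [NormedSpace ℝ F]
    {f : E → F} {x : E} {n : ℕ} (hf : ContDiffAt ℝ n f x) (σ : Equiv.Perm (Fin n))
    (v : Fin n → E) :
    iteratedFDeriv ℝ n f x (v ∘ σ) = iteratedFDeriv ℝ n f x v := by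
  rcases n with _ | n
  · congr 1
    exact Subsingleton.elim _ _
  · have hσ : σ ∈ Submonoid.closure
        (range fun i : Fin n => Equiv.swap i.castSucc i.succ) := by
      rw [Equiv.Perm.mclosure_swap_castSucc_succ]; trivial
    induction hσ using Submonoid.closure_induction generalizing v with
    | mem τ h =>
      obtain ⟨i, rfl⟩ := h
      exact iteratedFDeriv_comp_swap_adjacent n hf i v
    | one => rfl
    | mul a b _ _ ha hb =>
      rw [Equiv.Perm.coe_mul, ← Function.comp_assoc, hb, ha]

end Symmetry

/-! ### Taylor polynomials -/

section Taylor

variable {E : Type} [NormedAddCommGroup E] [NormedSpace ℝ E]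

/-- The Taylor polynomial of order `k` of `f` at `x`, as a formal multilinear series. -/
def taylorJet (k : ℕ) (f : E → ℝ) (x : E) : FormalMultilinearSeries ℝ E ℝ := fun n =>
  if n ≤ k then (n.factorial : ℝ)⁻¹ • iteratedFDeriv ℝ n f x else 0

lemma taylorJet_of_lt {k n : ℕ} (h : k < n) (f : E → ℝ) (x : E) : taylorJet k f x n = 0 := by
  simp [taylorJet, not_le.2 h]

lemma hasFPowerSeries_partialSum (p : FormalMultilinearSeries ℝ E ℝ) (k : ℕ)
    (hp : ∀ n, k < n → p n = 0) (x : E) :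
    HasFPowerSeriesOnBall (fun y => p.partialSum (k + 1) (y - x)) p x ⊤ := by
  have : HasFiniteFPowerSeriesOnBall (fun y => p.partialSum (k + 1) (y - x)) p x (k + 1) ⊤ := by
    refine HasFiniteFPowerSeriesOnBall.mk' (fun m hm => hp m hm) (by simp) ?_
    intro y _
    simp [FormalMultilinearSeries.partialSum]
  exact this.toHasFPowerSeriesOnBall

lemma iteratedFDeriv_taylorJet {k : ℕ} {f : E → ℝ} {x : E} (hf : ContDiffAt ℝ k f x) {i : ℕ}
    (hi : i ≤ k) :
    iteratedFDeriv ℝ i (fun y => (taylorJet k f x).partialSum (k + 1) (y - x)) x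
      = iteratedFDeriv ℝ i f x := by
  ext v
  rw [(hasFPowerSeries_partialSum (taylorJet k f x) k
    (fun n h => taylorJet_of_lt h f x) x).iteratedFDeriv_eq_sum_of_completeSpace]
  have hf' : ContDiffAt ℝ i f x := hf.of_le (by exact_mod_cast hi)
  have : ∀ σ : Equiv.Perm (Fin i), taylorJet k f x i (fun j => v (σ j))
      = (i.factorial : ℝ)⁻¹ * iteratedFDeriv ℝ i f x v := by
    intro σ
    simp only [taylorJet, hi, if_true, smul_apply, smul_eq_mul]
    exact congrArg _ (hf'.iteratedFDeriv_perm σ v)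
  simp only [this, Finset.sum_const, Finset.card_univ, Fintype.card_perm, Fintype.card_fin,
    nsmul_eq_mul]
  rw [← mul_assoc, mul_inv_cancel₀ (by positivity), one_mul]

lemma iteratedFDeriv_taylorJet_eq_zero {k i : ℕ} (f : E → ℝ) (x : E) (hi : k < i) :
    iteratedFDeriv ℝ i (fun y => (taylorJet k f x).partialSum (k + 1) (y - x)) x = 0 := by
  ext v
  rw [(hasFPowerSeries_partialSum (taylorJet k f x) k
    (fun n h => taylorJet_of_lt h f x) x).iteratedFDeriv_eq_sum_of_completeSpace]
  simp [taylorJet_of_lt hi]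

/-- Taylor estimate under a Hölder condition on the top derivative. -/
lemma abs_sub_taylorJet_le {k : ℕ} {f : E → ℝ} {x h : E} {B : ℝ}
    (hf : ∀ t ∈ Icc (0 : ℝ) 1, ContDiffAt ℝ k f (x + t • h))
    (hB : ∀ t ∈ Icc (0 : ℝ) 1,
      ‖iteratedFDeriv ℝ k f (x + t • h) - iteratedFDeriv ℝ k f x‖ ≤ B) :
    |f (x + h) - (taylorJet k f x).partialSum (k + 1) h| ≤ B * ‖h‖ ^ k := by
  rcases k with _ | n
  · have := hB 1 (by simp)
    have e : iteratedFDeriv ℝ 0 f (x + (1 : ℝ) • h) - iteratedFDeriv ℝ 0 f x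
        = (continuousMultilinearCurryFin0 ℝ E ℝ).symm (f (x + h) - f x) := by
      ext; simp
    rw [e, LinearIsometryEquiv.norm_map, Real.norm_eq_abs] at this
    simpa [FormalMultilinearSeries.partialSum, taylorJet] using this
  · have hx0 : ContDiffAt ℝ (n + 1 : ℕ) f x := by simpa using hf 0 (by simp)
    rw [map_add_eq_sum_add_integral_iteratedFDeriv (f := f) (x := x) (y := h) (n := n)
      (fun t ht => by simpa using hf t ht), FormalMultilinearSeries.partialSum,
      Finset.sum_range_succ _ (n + 1)]
    have e : ∑ i ∈ Finset.range (n + 1), (taylorJet (n + 1) f x i fun _ => h)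
        = ∑ i ∈ Finset.range (n + 1),
          (i.factorial : ℝ)⁻¹ • (iteratedFDeriv ℝ i f x fun _ => h) := by
      refine Finset.sum_congr rfl fun i hi => ?_
      have : i ≤ n + 1 := (Finset.mem_range.1 hi).le
      simp [taylorJet, this]
    rw [e, add_sub_add_left_eq_sub]
    have hcont : ContinuousOn (fun t : ℝ => iteratedFDeriv ℝ (n + 1) f (x + t • h) fun _ => h)
        (Icc 0 1) := by
      intro t ht
      have h1 : ContinuousAt (iteratedFDeriv ℝ (n + 1) f) (x + t • h) :=
        ((hf t ht).iteratedFDeriv_right (m := 0) (i := n + 1) (by simp)).continuousAt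
      have h2 : ContinuousAt (fun t : ℝ => x + t • h) t := by fun_prop
      have h3 : ContinuousAt (fun t : ℝ => iteratedFDeriv ℝ (n + 1) f (x + t • h)) t :=
        ContinuousAt.comp (f := fun t : ℝ => x + t • h) h1 h2
      exact ((ContinuousMultilinearMap.apply ℝ (fun _ : Fin (n + 1) => E) ℝ
        (fun _ => h)).continuous.continuousAt.comp h3).continuousWithinAt
    set a := iteratedFDeriv ℝ (n + 1) f x fun _ => h
    have hI : ∫ t in (0 : ℝ)..1, (1 - t) ^ n • a = ((n : ℝ) + 1)⁻¹ * a := by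
      rw [intervalIntegral.integral_smul_const,
        intervalIntegral.integral_comp_sub_left (fun t => t ^ n) 1]
      simp
    have hint1 : IntervalIntegrable (fun t : ℝ => (1 - t) ^ n •
        (iteratedFDeriv ℝ (n + 1) f (x + t • h) fun _ => h)) MeasureTheory.volume 0 1 := by
      apply ContinuousOn.intervalIntegrable
      rw [uIcc_of_le zero_le_one]
      have h1 : ContinuousOn (fun t : ℝ => (1 - t) ^ n) (Icc 0 1) := by fun_prop
      exact h1.smul hcont
    have hint2 : IntervalIntegrable (fun t : ℝ => (1 - t) ^ n • a) MeasureTheory.volume 0 1 := by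
      apply Continuous.intervalIntegrable
      fun_prop
    have e2 : (n.factorial : ℝ)⁻¹ • (∫ t in (0 : ℝ)..1, (1 - t) ^ n •
        (iteratedFDeriv ℝ (n + 1) f (x + t • h) fun _ => h))
        - (taylorJet (n + 1) f x (n + 1) fun _ => h)
        = (n.factorial : ℝ)⁻¹ * ∫ t in (0 : ℝ)..1, ((1 - t) ^ n •
          (iteratedFDeriv ℝ (n + 1) f (x + t • h) fun _ => h) - (1 - t) ^ n • a) := by
      rw [intervalIntegral.integral_sub hint1 hint2, hI]
      simp only [taylorJet, le_refl, if_true, smul_apply, smul_eq_mul, Nat.factorial_succ]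
      push_cast
      rw [mul_inv]
      ring
    rw [e2, abs_mul]
    have hbound : ‖∫ t in (0 : ℝ)..1, ((1 - t) ^ n •
          (iteratedFDeriv ℝ (n + 1) f (x + t • h) fun _ => h) - (1 - t) ^ n • a)‖
        ≤ (B * ‖h‖ ^ (n + 1)) * |1 - 0| := by
      apply intervalIntegral.norm_integral_le_of_norm_le_const
      intro t ht
      rw [uIoc_of_le zero_le_one] at ht
      have ht' : t ∈ Icc (0 : ℝ) 1 := ⟨ht.1.le, ht.2⟩
      rw [← smul_sub, norm_smul]
      have h1 : ‖(1 - t) ^ n‖ ≤ 1 := by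
        rw [norm_pow]
        apply pow_le_one₀ (norm_nonneg _)
        rw [Real.norm_eq_abs, abs_le]
        constructor <;> linarith [ht.1, ht.2]
      have h2 : ‖(iteratedFDeriv ℝ (n + 1) f (x + t • h) fun _ => h) - a‖
          ≤ B * ‖h‖ ^ (n + 1) := by
        have := (iteratedFDeriv ℝ (n + 1) f (x + t • h)
          - iteratedFDeriv ℝ (n + 1) f x).le_opNorm (fun _ => h)
        simp only [Finset.prod_const, Finset.card_univ, Fintype.card_fin] at this
        exact this.trans (mul_le_mul_of_nonneg_right (hB t ht') (by positivity))
      calc _ ≤ 1 * (B * ‖h‖ ^ (n + 1)) := mul_le_mul h1 h2 (norm_nonneg _) zero_le_one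
        _ = _ := one_mul _
    rw [Real.norm_eq_abs] at hbound
    have hfac : |(n.factorial : ℝ)⁻¹| ≤ 1 := by
      rw [abs_of_pos (by positivity)]
      exact inv_le_one_of_one_le₀ (by exact_mod_cast Nat.one_le_iff_ne_zero.2 n.factorial_ne_zero)
    calc _ ≤ 1 * (B * ‖h‖ ^ (n + 1) * |1 - 0|) :=
          mul_le_mul hfac hbound (abs_nonneg _) zero_le_one
      _ = _ := by simp

end Taylor

/-! ### Smoothing operators -/

section Smoothing

open MeasureTheory ContinuousLinearMap
open scoped Convolution

variable {E : Type} [NormedAddCommGroup E] [NormedSpace ℝ E]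

lemma exists_polynomial_partialSum_eq (p : FormalMultilinearSeries ℝ E ℝ) (k : ℕ) (a z : E) :
    ∃ Q : Polynomial ℝ, Q.natDegree ≤ k ∧
      ∀ s : ℝ, p.partialSum (k + 1) (a + s • z) = Q.eval s := by
  classical
  refine ⟨∑ n ∈ Finset.range (k + 1), ∑ S : Finset (Fin n),
    Polynomial.C (p n (S.piecewise (fun _ => a) (fun _ => z))) * Polynomial.X ^ (Sᶜ.card), ?_, ?_⟩
  · refine Polynomial.natDegree_sum_le_of_forall_le _ _ fun n hn => ?_
    refine Polynomial.natDegree_sum_le_of_forall_le _ _ fun S _ => ?_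
    refine (Polynomial.natDegree_C_mul_X_pow_le _ _).trans ?_
    refine (Finset.card_le_univ _).trans ?_
    have := Finset.mem_range.1 hn
    simp; omega
  · intro s
    simp only [FormalMultilinearSeries.partialSum, Polynomial.eval_finsetSum, Polynomial.eval_mul,
      Polynomial.eval_C, Polynomial.eval_pow, Polynomial.eval_X]
    refine Finset.sum_congr rfl fun n _ => ?_
    have h := (p n).map_add_univ (fun _ => a) (fun _ => s • z)
    rw [show (fun _ : Fin n => a + s • z) = (fun _ => a) + fun _ => s • z from rfl, h]
    refine Finset.sum_congr rfl fun S _ => ?_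
    have : S.piecewise (fun _ : Fin n => a) (fun _ => s • z)
        = Sᶜ.piecewise (fun i => (fun _ : Fin n => s) i • S.piecewise (fun _ => a) (fun _ => z) i)
          (S.piecewise (fun _ => a) (fun _ => z)) := by
      funext i
      by_cases hi : i ∈ S <;> simp [hi, Finset.piecewise]
    rw [this, ContinuousMultilinearMap.map_piecewise_smul]
    simp [mul_comm]

/-- Polynomials of degree at most `k` are extrapolated exactly to `0` from `1, …, k + 1`. -/
lemma sum_choose_mul_partialSum (p : FormalMultilinearSeries ℝ E ℝ) (k : ℕ) (a z : E) :
    ∑ j ∈ Finset.range (k + 1), ((-1) ^ j * ((k + 1).choose (j + 1) : ℝ)) *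
      p.partialSum (k + 1) (a + ((j : ℝ) + 1) • z) = p.partialSum (k + 1) a := by
  obtain ⟨Q, hQ, h⟩ := exists_polynomial_partialSum_eq p k a z
  have h0 : p.partialSum (k + 1) a = Q.eval 0 := by simpa using h 0
  simp only [h, h0]
  have key := congrFun (Polynomial.fwdDiff_iter_eq_zero_of_degree_lt (Nat.lt_succ_of_le hQ)) 0
  rw [fwdDiff_iter_eq_sum_shift, Finset.sum_range_succ'] at key
  simp only [zero_add, nsmul_eq_mul, mul_one, Pi.zero_apply, zsmul_eq_mul, Nat.cast_add,
    Nat.cast_one, Nat.choose_zero_right] at key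
  push_cast at key
  simp only [Nat.succ_eq_add_one] at key
  have hs : ∀ j ∈ Finset.range (k + 1), ((-1 : ℝ) ^ (k - j)) = (-1) ^ k * (-1) ^ j := by
    intro j hj
    have hjk : j ≤ k := by have := Finset.mem_range.1 hj; omega
    rw [← pow_add, show k + j = (k - j) + 2 * j by omega, pow_add, pow_mul]
    simp
  rw [Finset.sum_congr rfl (fun j hj => by rw [hs j hj, mul_assoc, mul_assoc]),
    ← Finset.mul_sum, pow_succ] at key
  have : (-1 : ℝ) ^ k ≠ 0 := by positivity
  have h2 : (-1 : ℝ) ^ k * ((∑ j ∈ Finset.range (k + 1), (-1) ^ j *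
      (((k + 1).choose (j + 1) : ℝ) * Q.eval ((j : ℝ) + 1))) - Q.eval 0) = 0 := by
    linarith
  rcases mul_eq_zero.1 h2 with h3 | h3
  · exact absurd h3 this
  · simpa [mul_assoc] using sub_eq_zero.1 h3

variable [FiniteDimensional ℝ E] [MeasurableSpace E] [BorelSpace E]
  {μ : Measure E} [μ.IsAddHaarMeasure]

lemma norm_iteratedFDeriv_convolution_le (i : ℕ) :
    ∀ {F : Type} [NormedAddCommGroup F] [NormedSpace ℝ F] {g : E → ℝ} {η : E → F} {x : E}
      {B : ℝ}, LocallyIntegrable g μ → ContDiff ℝ ∞ η → HasCompactSupport η →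
      (∀ y, x - y ∈ tsupport η → |g y| ≤ B) →
      ‖iteratedFDeriv ℝ i (g ⋆[lsmul ℝ ℝ, μ] η) x‖
        ≤ B * ∫ y, ‖iteratedFDeriv ℝ i η y‖ ∂μ := by
  induction i with
  | zero =>
    intro F _ _ g η x B hg hη hc hB
    rw [norm_iteratedFDeriv_zero, convolution_def,
      ← integral_sub_left_eq_self (fun y => ‖iteratedFDeriv ℝ 0 η y‖) μ x, ← integral_const_mul]
    simp only [norm_iteratedFDeriv_zero]
    refine (norm_integral_le_integral_norm _).trans ?_
    refine integral_mono_of_nonneg (Eventually.of_forall fun y => norm_nonneg _) ?_ ?_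
    · apply Integrable.const_mul
      have := (hη.continuous.norm.integrable_of_hasCompactSupport (μ := μ) hc.norm)
      exact this.comp_sub_left x
    · refine Eventually.of_forall fun y => ?_
      simp only [lsmul_apply, norm_smul, Real.norm_eq_abs]
      by_cases hy : x - y ∈ tsupport η
      · exact mul_le_mul_of_nonneg_right (hB y hy) (norm_nonneg _)
      · simp [image_eq_zero_of_notMem_tsupport hy]
  | succ i ih =>
    intro F _ _ g η x B hg hη hc hB
    have hfd : fderiv ℝ (g ⋆[lsmul ℝ ℝ, μ] η) = g ⋆[lsmul ℝ ℝ, μ] fderiv ℝ η := by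
      funext y
      rw [(hc.hasFDerivAt_convolution_right (lsmul ℝ ℝ) hg (hη.of_le (by simp)) y).fderiv]
      rfl
    rw [← norm_iteratedFDeriv_fderiv, hfd]
    simp only [← norm_iteratedFDeriv_fderiv (n := i) (f := η)]
    exact ih hg (hη.fderiv_right (by simp)) (hc.fderiv ℝ)
      fun y hy => hB y (tsupport_fderiv_subset ℝ hy)

variable (μ) in
/-- The average of `g` against the kernel `κ` at scale `s`. -/
def kernelAverage (κ : E → ℝ) (s : ℝ) (g : E → ℝ) (x : E) : ℝ :=
  ((fun y => g (s • y)) ⋆[lsmul ℝ ℝ, μ] κ) (s⁻¹ • x)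

lemma locallyIntegrable_comp_smul {g : E → ℝ} (hg : LocallyIntegrable g μ) {s : ℝ} (hs : s ≠ 0) :
    LocallyIntegrable (fun y => g (s • y)) μ := by
  have h := (locallyIntegrable_map_homeomorph (Homeomorph.smulOfNeZero s hs) (f := g)
    (μ := μ)).1
  refine h ?_
  have := Measure.map_addHaar_smul μ hs
  rw [show (Homeomorph.smulOfNeZero s hs : E → E) = (s • ·) from rfl, this]
  intro x
  obtain ⟨t, ht, hi⟩ := hg x
  exact ⟨t, ht, by
    rw [IntegrableOn, Measure.restrict_smul]
    exact Integrable.smul_measure hi ENNReal.ofReal_ne_top⟩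

variable {κ : E → ℝ} {g h : E → ℝ} {s : ℝ}

lemma contDiff_kernelAverage (hκ : ContDiff ℝ ∞ κ) (hc : HasCompactSupport κ)
    (hg : LocallyIntegrable g μ) (hs : s ≠ 0) : ContDiff ℝ ∞ (kernelAverage μ κ s g) :=
  (hc.contDiff_convolution_right (lsmul ℝ ℝ) (locallyIntegrable_comp_smul hg hs) hκ).comp
    (contDiff_const_smul _)

lemma kernelAverage_sub (hκ : ContDiff ℝ ∞ κ) (hc : HasCompactSupport κ)
    (hg : LocallyIntegrable g μ) (hh : LocallyIntegrable h μ) (hs : s ≠ 0) :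
    kernelAverage μ κ s (g - h) = kernelAverage μ κ s g - kernelAverage μ κ s h := by
  funext x
  have h1 := hc.convolutionExists_right (lsmul ℝ ℝ) (locallyIntegrable_comp_smul hg hs)
    hκ.continuous (s⁻¹ • x)
  have h2 := hc.convolutionExists_right (lsmul ℝ ℝ) (locallyIntegrable_comp_smul hh hs)
    hκ.continuous (s⁻¹ • x)
  simp only [kernelAverage, convolution_def, Pi.sub_apply, map_sub]
  exact integral_sub h1 h2

lemma norm_iteratedFDeriv_kernelAverage_le (hκ : ContDiff ℝ ∞ κ) (hc : HasCompactSupport κ)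
    (hg : LocallyIntegrable g μ) (hs : 0 < s) {x : E} {B : ℝ}
    (hB : ∀ z, -z ∈ tsupport κ → |g (x + s • z)| ≤ B) (i : ℕ) :
    ‖iteratedFDeriv ℝ i (kernelAverage μ κ s g) x‖
      ≤ s⁻¹ ^ i * (B * ∫ y, ‖iteratedFDeriv ℝ i κ y‖ ∂μ) := by
  have hg' := locallyIntegrable_comp_smul hg hs.ne'
  have hcd := hc.contDiff_convolution_right (lsmul ℝ ℝ) hg' hκ
  have := iteratedFDeriv_comp_const_smul (𝕜 := ℝ) (i := i) s⁻¹ (hcd.of_le (by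
    exact_mod_cast le_top))
  unfold kernelAverage
  rw [this, norm_smul, norm_pow, norm_inv, Real.norm_eq_abs, abs_of_pos hs]
  refine mul_le_mul_of_nonneg_left ?_ (by positivity)
  refine norm_iteratedFDeriv_convolution_le i hg' hκ hc fun y hy => ?_
  have := hB (y - s⁻¹ • x) (by simpa using hy)
  simpa [smul_sub, smul_smul, hs.ne'] using this

lemma kernelAverage_eq_integral (hs : s ≠ 0) (x : E) :
    kernelAverage μ κ s g x = ∫ w, g (x + s • -w) * κ w ∂μ := by
  rw [kernelAverage, convolution_def, ← integral_sub_left_eq_self _ μ (s⁻¹ • x)]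
  simp [smul_smul, hs, sub_eq_add_neg]

variable (μ) in
/-- An extrapolated average at scale `ε`, reproducing polynomials of degree at most `k`. -/
def extrapolatedAverage (κ : E → ℝ) (k : ℕ) (ε : ℝ) (g : E → ℝ) (x : E) : ℝ :=
  ∑ j ∈ Finset.range (k + 1), ((-1) ^ j * ((k + 1).choose (j + 1) : ℝ)) *
    kernelAverage μ κ (((j : ℝ) + 1) * ε) g x

lemma extrapolatedAverage_partialSum (hκ : ContDiff ℝ ∞ κ) (hc : HasCompactSupport κ)
    (h1 : ∫ y, κ y ∂μ = 1) (k : ℕ) {ε : ℝ} (hε : 0 < ε) (p : FormalMultilinearSeries ℝ E ℝ)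
    (x : E) :
    extrapolatedAverage μ κ k ε (fun y => p.partialSum (k + 1) (y - x))
      = fun y => p.partialSum (k + 1) (y - x) := by
  funext y
  unfold extrapolatedAverage
  have hcont : Continuous (p.partialSum (k + 1)) := p.partialSum_continuous _
  have hint : ∀ j : ℕ, Integrable (fun w => p.partialSum (k + 1)
      (y + (((j : ℝ) + 1) * ε) • -w - x) * κ w) μ := fun j => by
    refine Continuous.integrable_of_hasCompactSupport ?_ hc.mul_left
    exact (hcont.comp (by fun_prop)).mul hκ.continuous
  have hs : ∀ j : ℕ, ((j : ℝ) + 1) * ε ≠ 0 := fun j => by positivity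
  simp only [kernelAverage_eq_integral (hs _), ← integral_const_mul]
  rw [← integral_finsetSum _ fun j _ => (hint j).const_mul _]
  have : ∀ w, ∑ j ∈ Finset.range (k + 1), ((-1) ^ j * ((k + 1).choose (j + 1) : ℝ)) *
      (p.partialSum (k + 1) (y + (((j : ℝ) + 1) * ε) • -w - x) * κ w)
      = p.partialSum (k + 1) (y - x) * κ w := fun w => by
    rw [← sum_choose_mul_partialSum p k (y - x) (ε • -w), Finset.sum_mul]
    refine Finset.sum_congr rfl fun j _ => ?_
    rw [mul_assoc, smul_smul, sub_add_eq_add_sub]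
    ring
  simp only [this]
  rw [integral_const_mul, h1, mul_one]

lemma contDiff_extrapolatedAverage (hκ : ContDiff ℝ ∞ κ) (hc : HasCompactSupport κ) (k : ℕ)
    {ε : ℝ} (hε : 0 < ε) (hg : LocallyIntegrable g μ) :
    ContDiff ℝ ∞ (extrapolatedAverage μ κ k ε g) :=
  ContDiff.sum fun _ _ => contDiff_const.mul
    (contDiff_kernelAverage hκ hc hg (by positivity))

lemma extrapolatedAverage_sub (hκ : ContDiff ℝ ∞ κ) (hc : HasCompactSupport κ) (k : ℕ)
    {ε : ℝ} (hε : 0 < ε) (hg : LocallyIntegrable g μ) (hh : LocallyIntegrable h μ) :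
    extrapolatedAverage μ κ k ε (g - h)
      = extrapolatedAverage μ κ k ε g - extrapolatedAverage μ κ k ε h := by
  funext x
  have hs : ∀ j : ℕ, ((j : ℝ) + 1) * ε ≠ 0 := fun j => by positivity
  simp only [extrapolatedAverage, kernelAverage_sub hκ hc hg hh (hs _), Pi.sub_apply, mul_sub,
    Finset.sum_sub_distrib]

lemma norm_iteratedFDeriv_extrapolatedAverage_le (hκ : ContDiff ℝ ∞ κ)
    (hc : HasCompactSupport κ) (k : ℕ) {ε : ℝ} (hε : 0 < ε) (hg : LocallyIntegrable g μ)
    {x : E} {B : ℝ} (hB0 : 0 ≤ B)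
    (hB : ∀ s, ε ≤ s → s ≤ (k + 1) * ε → ∀ z, -z ∈ tsupport κ → |g (x + s • z)| ≤ B) (i : ℕ) :
    ‖iteratedFDeriv ℝ i (extrapolatedAverage μ κ k ε g) x‖
      ≤ ((∑ j ∈ Finset.range (k + 1), ((k + 1).choose (j + 1) : ℝ)) *
        ∫ y, ‖iteratedFDeriv ℝ i κ y‖ ∂μ) * B * ε⁻¹ ^ i := by
  have hs : ∀ j : ℕ, 0 < ((j : ℝ) + 1) * ε := fun j => by positivity
  have hcd : ∀ j : ℕ, ContDiff ℝ i (kernelAverage μ κ (((j : ℝ) + 1) * ε) g) := fun j =>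
    (contDiff_kernelAverage hκ hc hg (hs j).ne').of_le (by exact_mod_cast le_top)
  unfold extrapolatedAverage
  rw [iteratedFDeriv_fun_sum_apply fun j _ => (contDiff_const.mul (hcd j)).contDiffAt]
  refine (norm_sum_le _ _).trans ?_
  rw [Finset.sum_mul, Finset.sum_mul, Finset.sum_mul]
  refine Finset.sum_le_sum fun j hj => ?_
  have := iteratedFDeriv_const_smul_apply (𝕜 := ℝ) (i := i) (x := x)
    (a := ((-1) ^ j * ((k + 1).choose (j + 1) : ℝ))) (hcd j).contDiffAt
  simp only [← smul_eq_mul (α := ℝ) ((-1) ^ j * _)]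
  rw [show (fun x => ((-1) ^ j * ((k + 1).choose (j + 1) : ℝ)) •
    kernelAverage μ κ (((j : ℝ) + 1) * ε) g x) = ((-1) ^ j * ((k + 1).choose (j + 1) : ℝ)) •
    kernelAverage μ κ (((j : ℝ) + 1) * ε) g from rfl, this, norm_smul]
  have hjk : (j : ℝ) + 1 ≤ k + 1 := by
    have := Finset.mem_range.1 hj
    exact_mod_cast this
  have hle : ε ≤ ((j : ℝ) + 1) * ε := by
    have : (0 : ℝ) ≤ j := by positivity
    nlinarith
  have hb := norm_iteratedFDeriv_kernelAverage_le hκ hc hg (hs j) (x := x) (B := B)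
    (hB _ hle (by gcongr)) i
  have hn : ‖(-1) ^ j * ((k + 1).choose (j + 1) : ℝ)‖ = ((k + 1).choose (j + 1) : ℝ) := by simp
  rw [hn, mul_assoc, mul_assoc]
  refine mul_le_mul_of_nonneg_left (hb.trans ?_) (by positivity)
  have hI : 0 ≤ ∫ y, ‖iteratedFDeriv ℝ i κ y‖ ∂μ := integral_nonneg fun y => norm_nonneg _
  calc _ ≤ ε⁻¹ ^ i * (B * ∫ y, ‖iteratedFDeriv ℝ i κ y‖ ∂μ) := by gcongr
    _ = _ := by ring

variable (μ) in
/-- Smoothing operators that only sample the values in a prescribed cone and are exact on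
polynomials of degree at most `k`. -/
theorem exists_smoothing (v : E) {ρ : ℝ} (hρ : 0 < ρ) (k : ℕ) :
    ∃ (M : ℝ → (E → ℝ) → E → ℝ) (C : ℕ → ℝ), (∀ i, 0 ≤ C i) ∧
      (∀ ε : ℝ, 0 < ε → ∀ g, LocallyIntegrable g μ → ContDiff ℝ ∞ (M ε g)) ∧
      ∀ ε : ℝ, 0 < ε → ∀ g, LocallyIntegrable g μ →
      ∀ (p : FormalMultilinearSeries ℝ E ℝ) (x : E) (B : ℝ),
        0 ≤ B → (∀ s, ε ≤ s → s ≤ (k + 1) * ε → ∀ z ∈ ball v ρ,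
          |g (x + s • z) - p.partialSum (k + 1) (s • z)| ≤ B) →
        ∀ i, ‖iteratedFDeriv ℝ i (M ε g) x
          - iteratedFDeriv ℝ i (fun y => p.partialSum (k + 1) (y - x)) x‖
            ≤ C i * B * ε⁻¹ ^ i := by
  let φ : ContDiffBump (-v) := ⟨ρ / 4, ρ / 2, by positivity, by linarith⟩
  set κ := φ.normed μ
  have hκ : ContDiff ℝ ∞ κ := φ.contDiff_normed
  have hc : HasCompactSupport κ := φ.hasCompactSupport_normed
  refine ⟨extrapolatedAverage μ κ k, fun i => (∑ j ∈ Finset.range (k + 1),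
    ((k + 1).choose (j + 1) : ℝ)) * ∫ y, ‖iteratedFDeriv ℝ i κ y‖ ∂μ, fun i => ?_,
    fun ε hε g hg => contDiff_extrapolatedAverage hκ hc k hε hg,
    fun ε hε g hg p x B hB0 hB i => ?_⟩
  · exact mul_nonneg (by positivity) (integral_nonneg fun y => norm_nonneg _)
  set P : E → ℝ := fun y => p.partialSum (k + 1) (y - x)
  have hP : LocallyIntegrable P μ :=
    ((p.partialSum_continuous _).comp (continuous_id.sub continuous_const)).locallyIntegrable
  have hcd : ∀ g, LocallyIntegrable g μ → ContDiff ℝ i (extrapolatedAverage μ κ k ε g) :=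
    fun g hg => (contDiff_extrapolatedAverage hκ hc k hε hg).of_le (by exact_mod_cast le_top)
  have heq : extrapolatedAverage μ κ k ε P = P :=
    extrapolatedAverage_partialSum hκ hc φ.integral_normed k hε p x
  rw [← heq, ← iteratedFDeriv_sub_apply (hcd g hg).contDiffAt (hcd P hP).contDiffAt,
    ← extrapolatedAverage_sub hκ hc k hε hg hP]
  refine norm_iteratedFDeriv_extrapolatedAverage_le hκ hc k hε (hg.sub hP) hB0
    (fun s h1 h2 z hz => ?_) i
  rw [show tsupport κ = closedBall (-v) (ρ / 2) from φ.tsupport_normed_eq] at hz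
  have hz' : z ∈ ball v ρ := by
    rw [mem_closedBall, dist_neg_neg] at hz
    rw [mem_ball]; linarith
  simpa [P] using hB s h1 h2 z hz'

end Smoothing

section HolderBound

variable {E : Type} [NormedAddCommGroup E] [NormedSpace ℝ E] {Ω s : Set E} {f : E → ℝ} {t N : ℝ}

/-- `N` bounds the derivatives of order at most `⌊t⌋` and the top Hölder seminorm of `f`. -/
structure HolderBound (t : ℝ) (s : Set E) (f : E → ℝ) (N : ℝ) : Prop where
  contDiffOn : ContDiffOn ℝ (⌊t⌋₊ : ℕ) f s
  norm_le : ∀ i ≤ ⌊t⌋₊, ∀ x ∈ s, ‖iteratedFDerivWithin ℝ i f s x‖ ≤ N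
  holder : ∀ x ∈ s, ∀ y ∈ s,
    ‖iteratedFDerivWithin ℝ ⌊t⌋₊ f s x - iteratedFDerivWithin ℝ ⌊t⌋₊ f s y‖
      ≤ N * ‖x - y‖ ^ (t - (⌊t⌋₊ : ℝ))

lemma ctNorm_nonneg (t : ℝ) (s : Set E) (f : E → ℝ) : 0 ≤ ctNorm t s f := by
  refine le_max_of_le_left (Real.sSup_nonneg ?_)
  rintro r ⟨i, -, x, -, rfl⟩
  exact norm_nonneg _

lemma MemCt.holderBound (ht : 0 ≤ t) (hf : MemCt t s f) : HolderBound t s f (ctNorm t s f) := by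
  obtain ⟨h1, ⟨C, hC⟩, ⟨C', hC'⟩⟩ := hf
  refine ⟨h1, fun i hi x hx => ?_, fun x hx y hy => ?_⟩
  · refine le_trans (le_csSup ⟨C, ?_⟩ ?_) (le_max_left _ _)
    · rintro r ⟨i, hi, x, hx, rfl⟩
      exact hC i hi x hx
    · exact ⟨i, (Nat.le_floor_iff ht).1 hi, x, hx, rfl⟩
  · rcases eq_or_ne x y with rfl | hxy
    · simpa using mul_nonneg (ctNorm_nonneg t s f) (Real.rpow_nonneg le_rfl _)
    · have hpos : 0 < ‖x - y‖ ^ (t - (⌊t⌋₊ : ℝ)) :=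
        Real.rpow_pos_of_pos (norm_pos_iff.2 (sub_ne_zero.2 hxy)) _
      rw [← div_le_iff₀ hpos]
      refine le_trans (le_csSup ⟨C', ?_⟩ ?_) (le_max_right _ _)
      · rintro r ⟨x, hx, y, hy, hne, rfl⟩
        rw [div_le_iff₀ (Real.rpow_pos_of_pos (norm_pos_iff.2 (sub_ne_zero.2 hne)) _)]
        exact hC' x hx y hy
      · exact ⟨x, hx, y, hy, hxy, rfl⟩

lemma HolderBound.memCt (ht : 0 ≤ t) (hf : HolderBound t s f N) : MemCt t s f :=
  ⟨hf.contDiffOn, ⟨N, fun i hi => hf.norm_le i ((Nat.le_floor_iff ht).2 hi)⟩, ⟨N, hf.holder⟩⟩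

lemma HolderBound.ctNorm_le (ht : 0 ≤ t) (hf : HolderBound t s f N) (hN : 0 ≤ N) :
    ctNorm t s f ≤ N := by
  refine max_le (Real.sSup_le ?_ hN) (Real.sSup_le ?_ hN)
  · rintro r ⟨i, hi, x, hx, rfl⟩
    exact hf.norm_le i ((Nat.le_floor_iff ht).2 hi) x hx
  · rintro r ⟨x, hx, y, hy, hne, rfl⟩
    rw [div_le_iff₀ (Real.rpow_pos_of_pos (norm_pos_iff.2 (sub_ne_zero.2 hne)) _)]
    exact hf.holder x hx y hy

lemma iteratedFDerivWithin_closure_of_mem (hΩ : IsOpen Ω) {x : E} (hx : x ∈ Ω) (i : ℕ) :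
    iteratedFDerivWithin ℝ i f (closure Ω) x = iteratedFDeriv ℝ i f x := by
  rw [← iteratedFDerivWithin_univ]
  refine iteratedFDerivWithin_congr_set ?_ i
  have : closure Ω ∈ 𝓝 x := mem_of_superset (hΩ.mem_nhds hx) subset_closure
  exact eventuallyEq_univ.2 this

lemma HolderBound.contDiffAt (hΩ : IsOpen Ω) (hf : HolderBound t (closure Ω) f N) {x : E}
    (hx : x ∈ Ω) : ContDiffAt ℝ (⌊t⌋₊ : ℕ) f x :=
  hf.contDiffOn.contDiffAt (mem_of_superset (hΩ.mem_nhds hx) subset_closure)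

lemma HolderBound.norm_iteratedFDeriv_le (hΩ : IsOpen Ω) (hf : HolderBound t (closure Ω) f N)
    {i : ℕ} (hi : i ≤ ⌊t⌋₊) {x : E} (hx : x ∈ Ω) : ‖iteratedFDeriv ℝ i f x‖ ≤ N := by
  rw [← iteratedFDerivWithin_closure_of_mem hΩ hx]
  exact hf.norm_le i hi x (subset_closure hx)

lemma HolderBound.abs_sub_taylorJet_le (hΩ : IsOpen Ω) (ht : 0 < t) (hN : 0 ≤ N)
    (hf : HolderBound t (closure Ω) f N) {x h : E} (hseg : ∀ r ∈ Icc (0 : ℝ) 1, x + r • h ∈ Ω) :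
    |f (x + h) - (taylorJet ⌊t⌋₊ f x).partialSum (⌊t⌋₊ + 1) h| ≤ N * ‖h‖ ^ t := by
  have hθ : 0 ≤ t - (⌊t⌋₊ : ℝ) := sub_nonneg.2 (Nat.floor_le ht.le)
  have hx : x ∈ Ω := by simpa using hseg 0 (by simp)
  refine (_root_.abs_sub_taylorJet_le (B := N * ‖h‖ ^ (t - (⌊t⌋₊ : ℝ)))
    (fun r hr => hf.contDiffAt hΩ (hseg r hr)) fun r hr => ?_).trans ?_
  · rw [← iteratedFDerivWithin_closure_of_mem hΩ hx,
      ← iteratedFDerivWithin_closure_of_mem hΩ (hseg r hr)]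
    refine (hf.holder _ (subset_closure (hseg r hr)) _ (subset_closure hx)).trans ?_
    refine mul_le_mul_of_nonneg_left (Real.rpow_le_rpow (norm_nonneg _) ?_ hθ) hN
    rw [add_sub_cancel_left, norm_smul, Real.norm_eq_abs, abs_of_nonneg hr.1]
    exact mul_le_of_le_one_left (norm_nonneg _) hr.2
  · rw [mul_assoc, ← Real.rpow_natCast, ← Real.rpow_add' (norm_nonneg _) (by simpa using ht.ne'),
      sub_add_cancel]

end HolderBound

section LocalSmoothing

open MeasureTheory

variable {E : Type} [NormedAddCommGroup E] [NormedSpace ℝ E] [FiniteDimensional ℝ E]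

/-- Translating points of `closure Ω ∩ V` in directions near `v` leads into `Ω`. -/
def ConeProperty (Ω V : Set E) (v : E) (ρ s₀ : ℝ) : Prop :=
  ∀ x ∈ closure Ω ∩ V, ∀ s, 0 < s → s ≤ s₀ → ∀ z ∈ ball v ρ, x + s • z ∈ Ω

/-- Near points with the cone property, functions in `C^t` are approximated by smooth ones. -/
theorem ConeProperty.exists_approx {Ω V : Set E} (hΩ : IsOpen Ω) (hb : Bornology.IsBounded Ω)
    {v : E} {ρ s₀ : ℝ} (hρ : 0 < ρ) (hs₀ : 0 < s₀) (hV : ConeProperty Ω V v ρ s₀) {t : ℝ}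
    (ht : 0 < t) (K : ℕ) :
    ∃ C ε₀, 0 ≤ C ∧ 0 < ε₀ ∧ ∀ ε, 0 < ε → ε ≤ ε₀ → ∀ N f, 0 ≤ N →
      HolderBound t (closure Ω) f N → ∃ u : E → ℝ, ContDiff ℝ ∞ u ∧ ∀ x ∈ Ω ∩ V,
        (∀ i ≤ ⌊t⌋₊, ‖iteratedFDeriv ℝ i f x - iteratedFDeriv ℝ i u x‖ ≤ C * N * ε ^ (t - i)) ∧
        ∀ i, ⌊t⌋₊ < i → i ≤ K → ‖iteratedFDeriv ℝ i u x‖ ≤ C * N * ε ^ (t - i) := by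
  borelize E
  let μ : Measure E := Measure.addHaar
  set k := ⌊t⌋₊
  obtain ⟨M, C, hC, hM, hMb⟩ := exists_smoothing μ v hρ k
  have hR : 0 < ‖v‖ + ρ := by positivity
  have hA : 0 ≤ (((k : ℝ) + 1) * (‖v‖ + ρ)) ^ t := by positivity
  have hCs : ∀ i ≤ max K k, C i ≤ ∑ i ∈ Finset.range (max K k + 1), C i := fun i hi =>
    Finset.single_le_sum (fun j _ => hC j) (Finset.mem_range.2 (by omega))
  refine ⟨(∑ i ∈ Finset.range (max K k + 1), C i) * (((k : ℝ) + 1) * (‖v‖ + ρ)) ^ t,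
    s₀ / (k + 1), mul_nonneg (Finset.sum_nonneg fun i _ => hC i) hA, by positivity,
    fun ε hε hε₀ N f hN hf => ?_⟩
  have hli : LocallyIntegrable (Ω.indicator f) μ := by
    refine Integrable.locallyIntegrable ?_
    rw [integrable_indicator_iff hΩ.measurableSet]
    have : IsCompact (closure Ω) := hb.isCompact_closure
    exact (hf.contDiffOn.continuousOn.integrableOn_compact this).mono_set subset_closure
  refine ⟨M ε (Ω.indicator f), hM ε hε _ hli, fun x hx => ?_⟩
  have hkey := hMb ε hε _ hli (taylorJet k f x) x (N * ((k + 1) * ε * (‖v‖ + ρ)) ^ t)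
    (by positivity) fun s h1 h2 z hz => by
    have hs : 0 < s := hε.trans_le h1
    have hs' : s ≤ s₀ := h2.trans (by rw [le_div_iff₀ (by positivity)] at hε₀; linarith)
    have hmem : ∀ r ∈ Icc (0 : ℝ) 1, x + r • s • z ∈ Ω := fun r hr => by
      rcases hr.1.eq_or_lt with rfl | h0
      · simpa using hx.1
      · rw [smul_smul]
        exact hV x ⟨subset_closure hx.1, hx.2⟩ _ (by positivity)
          ((mul_le_of_le_one_left hs.le hr.2).trans hs') z hz
    have h1mem := hmem 1 (by simp)
    rw [one_smul] at h1mem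
    rw [indicator_of_mem h1mem]
    refine (hf.abs_sub_taylorJet_le hΩ ht hN hmem).trans ?_
    have hz' : ‖z‖ ≤ ‖v‖ + ρ := by
      have := norm_sub_norm_le z v
      rw [mem_ball, dist_eq_norm] at hz
      linarith
    rw [norm_smul, Real.norm_eq_abs, abs_of_pos hs]
    gcongr
  have hkey' : ∀ i ≤ max K k, ‖iteratedFDeriv ℝ i (M ε (Ω.indicator f)) x - iteratedFDeriv ℝ i
      (fun y => (taylorJet k f x).partialSum (k + 1) (y - x)) x‖ ≤
      (∑ i ∈ Finset.range (max K k + 1), C i) * (((k : ℝ) + 1) * (‖v‖ + ρ)) ^ t * N *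
        ε ^ (t - i) := fun i hi => by
    refine (hkey i).trans ?_
    rw [show ((k : ℝ) + 1) * ε * (‖v‖ + ρ) = ((k : ℝ) + 1) * (‖v‖ + ρ) * ε by ring,
      Real.mul_rpow (by positivity) hε.le, Real.rpow_sub hε, Real.rpow_natCast, inv_pow]
    calc _ = C i * ((((k : ℝ) + 1) * (‖v‖ + ρ)) ^ t * N * (ε ^ t / ε ^ i)) := by
          rw [div_eq_mul_inv]; ring
      _ ≤ (∑ i ∈ Finset.range (max K k + 1), C i) *
          ((((k : ℝ) + 1) * (‖v‖ + ρ)) ^ t * N * (ε ^ t / ε ^ i)) :=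
        mul_le_mul_of_nonneg_right (hCs i hi) (by positivity)
      _ = _ := by ring
  refine ⟨fun i hi => ?_, fun i hi hiK => ?_⟩
  · have := hkey' i (le_max_of_le_right hi)
    rwa [iteratedFDeriv_taylorJet (hf.contDiffAt hΩ hx.1) hi, norm_sub_rev] at this
  · have := hkey' i (le_max_of_le_left hiK)
    rwa [iteratedFDeriv_taylorJet_eq_zero f x hi, sub_zero] at this

end LocalSmoothing

section Geometry

variable {E : Type} [NormedAddCommGroup E] [NormedSpace ℝ E]

/-- A smooth hypersurface is locally a retract. -/
lemma exists_retraction_zeroLocus [CompleteSpace E] {φ : E → ℝ} {x₀ v : E} {K : ℕ}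
    (hφ : ContDiffAt ℝ K φ x₀) (hK : K ≠ 0) (h0 : φ x₀ = 0) (hv : fderiv ℝ φ x₀ v = -1) :
    ∃ π : E → E, ContDiffAt ℝ K π x₀ ∧ π x₀ = x₀ ∧
      ∀ᶠ x in 𝓝 x₀, φ (π x) = 0 ∧ (φ x = 0 → π x = x) := by
  set ℓ := fderiv ℝ φ x₀
  have hK' : (K : WithTop ℕ∞) ≠ 0 := by exact_mod_cast hK
  let H : E → E := fun x => (x - x₀) + (ℓ (x - x₀)) • v - φ x • v
  have hH : ContDiffAt ℝ K H x₀ := by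
    have : ContDiffAt ℝ K (fun x => (x - x₀) + (ℓ (x - x₀)) • v) x₀ := by fun_prop
    exact this.sub (hφ.smul contDiffAt_const)
  have hφd : HasFDerivAt φ ℓ x₀ := (hφ.differentiableAt hK').hasFDerivAt
  have hH' : HasFDerivAt H ((ContinuousLinearEquiv.refl ℝ E : E ≃L[ℝ] E) : E →L[ℝ] E) x₀ := by
    have h1 : HasFDerivAt (fun x => x - x₀) (ContinuousLinearMap.id ℝ E) x₀ :=
      (hasFDerivAt_id x₀).sub_const x₀
    have h2 := (ℓ.hasFDerivAt.comp x₀ h1).smul_const v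
    have h3 := (h1.add h2).sub (hφd.smul_const v)
    have he : ContinuousLinearMap.id ℝ E + (ℓ ∘SL ContinuousLinearMap.id ℝ E).smulRight v
        - ℓ.smulRight v = ((ContinuousLinearEquiv.refl ℝ E : E ≃L[ℝ] E) : E →L[ℝ] E) := by
      ext w
      simp
    rwa [he] at h3
  have hH0 : H x₀ = 0 := by simp [H, h0]
  have hℓH : ∀ x, ℓ (H x) = φ x := fun x => by
    simp only [H, map_sub, map_add, map_smul, smul_eq_mul, hv]; ring
  let J := hH.localInverse hH' hK'
  have hJ : ContDiffAt ℝ K J (H x₀) := hH.to_localInverse hH' hK'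
  have hJ0 : J (H x₀) = x₀ := hH.localInverse_apply_image hH' hK'
  have hst := hH.hasStrictFDerivAt' hH' hK'
  have hr : ∀ᶠ y in 𝓝 (H x₀), H (J y) = y := hst.eventually_right_inverse
  have hl : ∀ᶠ x in 𝓝 x₀, J (H x) = x := hst.eventually_left_inverse
  let Q : E → E := fun y => y + ℓ y • v
  have hQ0 : Q (H x₀) = H x₀ := by simp [Q, hH0]
  have hQ : ContDiffAt ℝ K (fun x => Q (H x)) x₀ :=
    ContDiffAt.comp x₀ (g := Q) (by fun_prop) hH
  refine ⟨fun x => J (Q (H x)), ?_, by simp only [hQ0, hJ0], ?_⟩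
  · refine ContDiffAt.comp x₀ (g := J) (f := fun x => Q (H x)) ?_ hQ
    simpa only [hQ0] using hJ
  · have hQt : Tendsto (fun x => Q (H x)) (𝓝 x₀) (𝓝 (H x₀)) := by
      simpa only [hQ0] using hQ.continuousAt.tendsto
    filter_upwards [hl, hQt.eventually hr] with x h1 h2
    refine ⟨?_, fun hx => ?_⟩
    · rw [← hℓH, h2]
      simp [Q, hv]
    · have : Q (H x) = H x := by simp [Q, hℓH, hx]
      rw [this, h1]

lemma exists_norm_iteratedFDeriv_le_pow {π : E → E} {x₀ : E} {K : ℕ} (h : ContDiffAt ℝ K π x₀) :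
    ∃ D : ℝ, 1 ≤ D ∧ ∀ᶠ x in 𝓝 x₀, ∀ i, 1 ≤ i → i ≤ K → ‖iteratedFDeriv ℝ i π x‖ ≤ D ^ i := by
  refine ⟨1 + ∑ i ∈ Finset.range (K + 1), (‖iteratedFDeriv ℝ i π x₀‖ + 1), ?_, ?_⟩
  · have : 0 ≤ ∑ i ∈ Finset.range (K + 1), (‖iteratedFDeriv ℝ i π x₀‖ + 1) :=
      Finset.sum_nonneg fun i _ => by positivity
    linarith
  · have : ∀ᶠ x in 𝓝 x₀, ∀ i ∈ Finset.range (K + 1),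
        ‖iteratedFDeriv ℝ i π x‖ < ‖iteratedFDeriv ℝ i π x₀‖ + 1 := by
      rw [Filter.eventually_all_finset]
      intro i hi
      have hi' : i ≤ K := by have := Finset.mem_range.1 hi; omega
      exact (h.continuousAt_iteratedFDeriv (by exact_mod_cast hi')).norm.eventually_lt_const
        (by simp)
    filter_upwards [this] with x hx i hi1 hiK
    have hm : i ∈ Finset.range (K + 1) := Finset.mem_range.2 (by omega)
    have h1 : ‖iteratedFDeriv ℝ i π x₀‖ + 1
        ≤ ∑ i ∈ Finset.range (K + 1), (‖iteratedFDeriv ℝ i π x₀‖ + 1) :=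
      Finset.single_le_sum (f := fun i => ‖iteratedFDeriv ℝ i π x₀‖ + 1)
        (fun j _ => by positivity) hm
    refine (hx i hm).le.trans ((h1.trans (le_add_of_nonneg_left zero_le_one)).trans ?_)
    refine le_self_pow₀ ?_ (by omega)
    have := norm_nonneg (iteratedFDeriv ℝ i π x₀)
    linarith

/-- Near every boundary point, a smoothly bounded open set has the cone property and its boundary
is a retract. -/
theorem HasSmoothBoundary.exists_coneProperty [CompleteSpace E] {Ω : Set E} (hΩ : IsOpen Ω)
    (hs : HasSmoothBoundary Ω) {x₀ : E} (hx₀ : x₀ ∈ frontier Ω) {K : ℕ} (hK : K ≠ 0) :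
    ∃ (V' V : Set E) (v : E) (ρ s₀ D : ℝ) (π : E → E), IsOpen V' ∧ IsOpen V ∧ x₀ ∈ V ∧ V ⊆ V' ∧
      0 < ρ ∧ 0 < s₀ ∧ ConeProperty Ω V' v ρ s₀ ∧ 1 ≤ D ∧ ∀ x ∈ V, ContDiffAt ℝ K π x ∧
        π x ∈ V' ∩ frontier Ω ∧ (x ∈ frontier Ω → π x = x) ∧
        ∀ i, 1 ≤ i → i ≤ K → ‖iteratedFDeriv ℝ i π x‖ ≤ D ^ i := by
  obtain ⟨U, φ, hU, hxU, hφ, hdφ, hΩU⟩ := hs x₀ hx₀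
  have hneg : ∀ x ∈ closure Ω ∩ U, φ x ≤ 0 := fun x hx => by
    have h1 : x ∈ closure (Ω ∩ U) := hU.closure_inter hx
    rw [hΩU] at h1
    have : closure {y | y ∈ U ∧ φ y < 0} ⊆ {y | φ y ≤ 0} :=
      closure_minimal (fun y hy => hy.2.le) (isClosed_le hφ.continuous continuous_const)
    exact this h1
  have hzero : ∀ x ∈ frontier Ω ∩ U, φ x = 0 := fun x hx => by
    refine le_antisymm (hneg x ⟨hx.1.1, hx.2⟩) (not_lt.1 fun hlt => ?_)
    have : x ∈ Ω ∩ U := by rw [hΩU]; exact ⟨hx.2, hlt⟩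
    rw [hΩ.frontier_eq] at hx
    exact hx.1.2 this.1
  obtain ⟨v, hv⟩ : ∃ v, fderiv ℝ φ x₀ v = -1 := by
    obtain ⟨w, hw⟩ : ∃ w, fderiv ℝ φ x₀ w ≠ 0 := by
      by_contra! h
      exact hdφ x₀ hxU (ContinuousLinearMap.ext h)
    exact ⟨(-(fderiv ℝ φ x₀ w)⁻¹) • w, by simp [hw]⟩
  have hdc : Continuous (fun q : E × E => fderiv ℝ φ q.1 q.2) :=
    ((hφ.continuous_fderiv (by simp)).comp continuous_fst).clm_apply continuous_snd
  have hev : ∀ᶠ q in 𝓝 (x₀, v), fderiv ℝ φ q.1 q.2 < 0 :=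
    hdc.continuousAt.eventually_lt_const (by simp [hv])
  rw [nhds_prod_eq] at hev
  obtain ⟨p₁, hp₁, p₂, hp₂, hp⟩ := eventually_prod_iff.1 hev
  obtain ⟨r, hr, hrU⟩ := Metric.eventually_nhds_iff_ball.1 (hp₁.and (hU.mem_nhds hxU))
  obtain ⟨ρ, hρ, hρp⟩ := Metric.eventually_nhds_iff_ball.1 hp₂
  have hR : 0 < ‖v‖ + ρ := by positivity
  have hcone : ∀ x ∈ ball x₀ (r / 2), φ x ≤ 0 → ∀ s, 0 < s → s ≤ r / 2 / (‖v‖ + ρ) →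
      ∀ z ∈ ball v ρ, x + s • z ∈ Ω := fun x hx hx0 s hs hsle z hz => by
    have hz' : ‖z‖ < ‖v‖ + ρ := by
      have := norm_sub_norm_le z v
      rw [mem_ball, dist_eq_norm] at hz
      linarith
    have hxr : x ∈ ball x₀ r := ball_subset_ball (by linarith) hx
    have hsz : ‖s • z‖ < r / 2 := by
      rw [norm_smul, Real.norm_eq_abs, abs_of_pos hs]
      rw [le_div_iff₀ hR] at hsle
      exact (mul_lt_mul_of_pos_left hz' hs).trans_le hsle
    have hyr : x + s • z ∈ ball x₀ r := by
      rw [mem_ball, dist_eq_norm] at hx ⊢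
      calc ‖x + s • z - x₀‖ = ‖(x - x₀) + s • z‖ := by rw [sub_add_eq_add_sub]
        _ ≤ ‖x - x₀‖ + ‖s • z‖ := norm_add_le _ _
        _ < r := by linarith
    obtain ⟨y, hy, hyeq⟩ := domain_mvt (f := φ) (f' := fderiv ℝ φ) (s := ball x₀ r)
      (fun y _ => ((hφ.differentiable (by simp)) y).hasFDerivAt.hasFDerivWithinAt)
      (convex_ball _ _) hxr hyr
    have hyb : y ∈ ball x₀ r := (convex_ball x₀ r).segment_subset hxr hyr hy
    have hlt : fderiv ℝ φ y z < 0 := hp (hrU y hyb).1 (hρp z hz)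
    have : φ (x + s • z) < 0 := by
      rw [add_sub_cancel_left, map_smul, smul_eq_mul] at hyeq
      nlinarith
    have hm : x + s • z ∈ Ω ∩ U := by rw [hΩU]; exact ⟨(hrU _ hyr).2, this⟩
    exact hm.1
  have hs₀ : 0 < r / 2 / (‖v‖ + ρ) := by positivity
  have hfr : ∀ x ∈ ball x₀ (r / 2), φ x = 0 → x ∈ frontier Ω := fun x hx hx0 => by
    have hxU' : x ∈ U := (hrU x (ball_subset_ball (by linarith) hx)).2
    rw [hΩ.frontier_eq]
    refine ⟨?_, fun hxΩ => ?_⟩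
    · have ht : Tendsto (fun s : ℝ => x + s • v) (𝓝[>] 0) (𝓝 x) := by
        have : Continuous (fun s : ℝ => x + s • v) := by fun_prop
        have := (this.tendsto 0).mono_left (nhdsWithin_le_nhds (s := Ioi 0))
        simpa using this
      refine mem_closure_of_tendsto ht ?_
      filter_upwards [Ioc_mem_nhdsGT hs₀] with s hs
      exact hcone x hx hx0.le s hs.1 hs.2 v (mem_ball_self hρ)
    · have : x ∈ {y | y ∈ U ∧ φ y < 0} := hΩU ▸ ⟨hxΩ, hxU'⟩
      exact this.2.ne hx0
  have hsub : ball x₀ (r / 2) ⊆ U := fun y hy => (hrU y (ball_subset_ball (by linarith) hy)).2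
  have hφK : ContDiffAt ℝ K φ x₀ := hφ.contDiffAt.of_le (by exact_mod_cast le_top)
  obtain ⟨π, hπ, hπ0, hπe⟩ := exists_retraction_zeroLocus hφK hK
    (hzero x₀ ⟨hx₀, hxU⟩) hv
  obtain ⟨D, hD, hDe⟩ := exists_norm_iteratedFDeriv_le_pow hπ
  have hball : ball x₀ (r / 2) ∈ 𝓝 x₀ := ball_mem_nhds _ (by linarith)
  have hπb : ∀ᶠ x in 𝓝 x₀, π x ∈ ball x₀ (r / 2) :=
    hπ.continuousAt.eventually_mem (by rwa [hπ0])
  have hall := (hπ.eventually (by simp)).and (hπb.and (hπe.and (hDe.and hball)))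
  obtain ⟨V, hVsub, hVo, hxV⟩ := _root_.eventually_nhds_iff.1 hall
  refine ⟨ball x₀ (r / 2), V, v, ρ, _, D, π, isOpen_ball, hVo, hxV,
    fun x hx => (hVsub x hx).2.2.2.2, hρ, hs₀, fun x hx s hs hsle z hz => ?_, hD,
    fun x hx => ?_⟩
  · exact hcone x hx.2 (hneg x ⟨hx.1, hsub hx.2⟩) s hs hsle z hz
  · obtain ⟨h1, h2, ⟨h3, h4⟩, h5, h6⟩ := hVsub x hx
    exact ⟨h1, ⟨h2, hfr _ h2 h3⟩, fun hxf => h4 (hzero x ⟨hxf, hsub h6⟩), h5⟩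

lemma IsOpen.exists_coneProperty {Ω : Set E} (hΩ : IsOpen Ω) {x₀ : E} (hx₀ : x₀ ∈ Ω) :
    ∃ (V : Set E) (ρ : ℝ), IsOpen V ∧ x₀ ∈ V ∧ V ⊆ Ω ∧ 0 < ρ ∧ ConeProperty Ω V 0 ρ 1 := by
  obtain ⟨r, hr, h⟩ := Metric.isOpen_iff.1 hΩ x₀ hx₀
  refine ⟨ball x₀ (r / 2), r / 2, isOpen_ball, mem_ball_self (by linarith),
    (ball_subset_ball (by linarith)).trans h, by linarith, fun x hx s hs hs1 z hz => h ?_⟩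
  have hx2 := hx.2
  rw [mem_ball, dist_eq_norm] at hx2 ⊢
  rw [mem_ball_zero_iff] at hz
  calc ‖x + s • z - x₀‖ = ‖(x - x₀) + s • z‖ := by rw [sub_add_eq_add_sub]
    _ ≤ ‖x - x₀‖ + ‖s • z‖ := norm_add_le _ _
    _ < r / 2 + r / 2 := by
      have : ‖s • z‖ ≤ ‖z‖ := by
        rw [norm_smul, Real.norm_eq_abs, abs_of_pos hs]
        exact mul_le_of_le_one_left (norm_nonneg _) hs1
      linarith
    _ = r := by ring

/-- Every point of the closure has a neighbourhood with the cone property. -/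
def LocallyConical (Ω : Set E) : Prop :=
  ∀ x₀ ∈ closure Ω, ∃ (V : Set E) (v : E) (ρ s₀ : ℝ), IsOpen V ∧ x₀ ∈ V ∧ 0 < ρ ∧ 0 < s₀ ∧
    ConeProperty Ω V v ρ s₀

lemma HasSmoothBoundary.locallyConical [CompleteSpace E] {Ω : Set E} (hΩ : IsOpen Ω)
    (hs : HasSmoothBoundary Ω) : LocallyConical Ω := by
  intro x₀ hx₀
  by_cases hx : x₀ ∈ Ω
  · obtain ⟨V, ρ, h1, h2, -, h3, h4⟩ := hΩ.exists_coneProperty hx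
    exact ⟨V, 0, ρ, 1, h1, h2, h3, one_pos, h4⟩
  · obtain ⟨V', V, v, ρ, s₀, D, π, h1, -, h2, h3, h4, h5, h6, -⟩ :=
      hs.exists_coneProperty hΩ (x₀ := x₀) (by rw [hΩ.frontier_eq]; exact ⟨hx₀, hx⟩) one_ne_zero
    exact ⟨V', v, ρ, s₀, h1, h3 h2, h4, h5, h6⟩

lemma LocallyConical.uniqueDiffOn {Ω : Set E} (h : LocallyConical Ω) :
    UniqueDiffOn ℝ (closure Ω) := by
  intro x hx
  obtain ⟨V, v, ρ, s₀, -, hxV, hρ, hs₀, hcone⟩ := h x hx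
  have hne : (ball (x + s₀ • v) (s₀ * ρ)).Nonempty := nonempty_ball.2 (by positivity)
  have hmem : ∀ y ∈ ball (x + s₀ • v) (s₀ * ρ), s₀⁻¹ • (y - x) ∈ ball v ρ := fun y hy => by
    rw [mem_ball, dist_eq_norm] at hy ⊢
    have : s₀⁻¹ • (y - x) - v = s₀⁻¹ • (y - (x + s₀ • v)) := by
      simp only [smul_sub, smul_add, smul_smul, inv_mul_cancel₀ hs₀.ne', one_smul]; abel
    rw [this, norm_smul, norm_inv, Real.norm_eq_abs, abs_of_pos hs₀, inv_mul_lt_iff₀ hs₀]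
    exact hy
  have hsub : convexHull ℝ (insert x (ball (x + s₀ • v) (s₀ * ρ))) ⊆ closure Ω := by
    rw [convexHull_insert hne, (convex_ball _ _).convexHull_eq]
    intro w hw
    obtain ⟨y, hy, hw⟩ : ∃ y ∈ ball (x + s₀ • v) (s₀ * ρ), w ∈ segment ℝ x y := by
      simpa [mem_convexJoin] using hw
    rw [segment_eq_image'] at hw
    obtain ⟨r, hr, rfl⟩ := hw
    rcases hr.1.eq_or_lt with rfl | h0
    · simpa using hx
    · refine subset_closure ?_
      have := hcone x ⟨hx, hxV⟩ (r * s₀) (by positivity) (mul_le_of_le_one_left hs₀.le hr.2) _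
        (hmem y hy)
      simpa [smul_smul, mul_assoc, hs₀.ne'] using this
  refine (uniqueDiffWithinAt_convex (convex_convexHull ℝ _) ?_ ?_).mono hsub
  · refine hne.mono (interior_maximal ?_ isOpen_ball)
    exact (subset_insert _ _).trans (subset_convexHull ℝ _)
  · exact subset_closure (subset_convexHull ℝ _ (mem_insert _ _))

/-- Close points are joined by short broken lines. -/
lemma LocallyConical.exists_brokenLine {Ω : Set E} (h : LocallyConical Ω)
    (hc : IsCompact (closure Ω)) :
    ∃ L δ : ℝ, 0 ≤ L ∧ 0 < δ ∧ ∀ x ∈ closure Ω, ∀ y ∈ closure Ω, ‖x - y‖ < δ →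
      ∃ p q, segment ℝ x p ⊆ closure Ω ∧ segment ℝ p q ⊆ closure Ω ∧ segment ℝ q y ⊆ closure Ω ∧
        ‖x - p‖ + ‖p - q‖ + ‖q - y‖ ≤ L * ‖x - y‖ := by
  suffices H : ∃ L δ : ℝ, 0 ≤ L ∧ 0 < δ ∧ ∀ x ∈ closure Ω, x ∈ closure Ω → ∀ y ∈ closure Ω,
      ‖x - y‖ < δ → ∃ p q, segment ℝ x p ⊆ closure Ω ∧ segment ℝ p q ⊆ closure Ω ∧
        segment ℝ q y ⊆ closure Ω ∧ ‖x - p‖ + ‖p - q‖ + ‖q - y‖ ≤ L * ‖x - y‖ by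
    obtain ⟨L, δ, h1, h2, h3⟩ := H
    exact ⟨L, δ, h1, h2, fun x hx => h3 x hx hx⟩
  refine hc.induction_on (p := fun S => ∃ L δ : ℝ, 0 ≤ L ∧ 0 < δ ∧ ∀ x ∈ S, x ∈ closure Ω →
    ∀ y ∈ closure Ω, ‖x - y‖ < δ → ∃ p q, segment ℝ x p ⊆ closure Ω ∧ segment ℝ p q ⊆ closure Ω ∧
        segment ℝ q y ⊆ closure Ω ∧ ‖x - p‖ + ‖p - q‖ + ‖q - y‖ ≤ L * ‖x - y‖) ?_ ?_ ?_ ?_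
  · exact ⟨0, 1, le_rfl, one_pos, by simp⟩
  · rintro S T hST ⟨L, δ, h1, h2, h3⟩
    exact ⟨L, δ, h1, h2, fun x hx => h3 x (hST hx)⟩
  · rintro S T ⟨L, δ, h1, h2, h3⟩ ⟨L', δ', h1', h2', h3'⟩
    refine ⟨max L L', min δ δ', le_max_of_le_left h1, lt_min h2 h2', fun x hx hxΩ y hy hxy => ?_⟩
    rcases hx with hx | hx
    · obtain ⟨p, q, a, b, c, d⟩ := h3 x hx hxΩ y hy (hxy.trans_le (min_le_left _ _))
      exact ⟨p, q, a, b, c, d.trans (by gcongr; exact le_max_left _ _)⟩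
    · obtain ⟨p, q, a, b, c, d⟩ := h3' x hx hxΩ y hy (hxy.trans_le (min_le_right _ _))
      exact ⟨p, q, a, b, c, d.trans (by gcongr; exact le_max_right _ _)⟩
  · intro x₀ hx₀
    obtain ⟨V, v, ρ, s₀, hV, hxV, hρ, hs₀, hcone⟩ := h x₀ hx₀
    obtain ⟨r, hr, hrV⟩ := Metric.isOpen_iff.1 hV x₀ hxV
    refine ⟨ball x₀ (r / 2), mem_nhdsWithin_of_mem_nhds (ball_mem_nhds _ (by linarith)),
      2 / ρ * ‖v‖ + 1 + 2 / ρ * ‖v‖, min (r / 2) (s₀ * ρ / 2), by positivity,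
      lt_min (by linarith) (by positivity), fun x hx hxΩ y hy hxy => ?_⟩
    have hxV' : x ∈ V := hrV (ball_subset_ball (by linarith) hx)
    have hyV : y ∈ V := hrV (by
      have h1 := hxy.trans_le (min_le_left _ _)
      rw [mem_ball] at hx ⊢
      rw [← dist_eq_norm, dist_comm] at h1
      have := dist_triangle y x x₀
      linarith)
    rcases eq_or_ne x y with rfl | hne
    · exact ⟨x, x, by simpa using hxΩ, by simpa using hxΩ, by simpa using hxΩ, by simp⟩
    have hpos : 0 < ‖x - y‖ := norm_pos_iff.2 (sub_ne_zero.2 hne)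
    set s := 2 / ρ * ‖x - y‖ with hs_def
    have hs : 0 < s := by positivity
    have hs' : s ≤ s₀ := by
      have h1 := hxy.trans_le (min_le_right _ _)
      rw [hs_def, div_mul_eq_mul_div, div_le_iff₀ hρ]
      linarith
    have hray : ∀ w ∈ closure Ω ∩ V, segment ℝ w (w + s • v) ⊆ closure Ω := fun w hw u hu => by
      rw [segment_eq_image'] at hu
      obtain ⟨τ, hτ, rfl⟩ := hu
      rcases hτ.1.eq_or_lt with rfl | h0
      · simpa using hw.1
      · have := hcone w hw (τ * s) (by positivity)
          ((mul_le_of_le_one_left hs.le hτ.2).trans hs') v (mem_ball_self hρ)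
        exact subset_closure (by simpa [smul_smul] using this)
    refine ⟨x + s • v, y + s • v, hray x ⟨hxΩ, hxV'⟩, fun u hu => ?_, ?_, ?_⟩
    · rw [segment_eq_image'] at hu
      obtain ⟨τ, hτ, rfl⟩ := hu
      have hz : v + (τ / s) • (y - x) ∈ ball v ρ := by
        rw [mem_ball, dist_eq_norm, add_sub_cancel_left, norm_smul, norm_sub_rev, Real.norm_eq_abs,
          abs_of_nonneg (div_nonneg hτ.1 hs.le), div_mul_eq_mul_div, div_lt_iff₀ hs, hs_def]
        have : ρ * (2 / ρ * ‖x - y‖) = 2 * ‖x - y‖ := by field_simp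
        rw [this]
        nlinarith [hτ.2]
      have := hcone x ⟨hxΩ, hxV'⟩ s hs hs' _ hz
      refine subset_closure ?_
      convert this using 1
      rw [smul_add, smul_smul, mul_div_cancel₀ _ hs.ne']
      abel_nf
    · rw [segment_symm]
      exact hray y ⟨hy, hyV⟩
    · have h1 : ‖x - (x + s • v)‖ = s * ‖v‖ := by
        rw [sub_add_cancel_left, norm_neg, norm_smul, Real.norm_eq_abs, abs_of_pos hs]
      have h2 : ‖y + s • v - y‖ = s * ‖v‖ := by
        rw [add_sub_cancel_left, norm_smul, Real.norm_eq_abs, abs_of_pos hs]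
      rw [h1, h2, add_sub_add_right_eq_sub, hs_def]
      exact le_of_eq (by ring)

lemma LocallyConical.exists_lipschitz {Ω : Set E} (h : LocallyConical Ω)
    (hc : IsCompact (closure Ω)) :
    ∃ L δ : ℝ, 0 ≤ L ∧ 0 < δ ∧ ∀ (f : E → ℝ) (n : ℕ) (B : ℝ),
      ContDiffOn ℝ (n + 1 : ℕ) f (closure Ω) →
      (∀ x ∈ closure Ω, ‖iteratedFDerivWithin ℝ (n + 1) f (closure Ω) x‖ ≤ B) →
      ∀ x ∈ closure Ω, ∀ y ∈ closure Ω, ‖x - y‖ < δ →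
        ‖iteratedFDerivWithin ℝ n f (closure Ω) x - iteratedFDerivWithin ℝ n f (closure Ω) y‖
          ≤ L * B * ‖x - y‖ := by
  obtain ⟨L, δ, hL, hδ, H⟩ := h.exists_brokenLine hc
  refine ⟨L, δ, hL, hδ, fun f n B hf hB x hx y hy hxy => ?_⟩
  obtain ⟨p, q, h1, h2, h3, hle⟩ := H x hx y hy hxy
  have hu := h.uniqueDiffOn
  have hd := hf.differentiableOn_iteratedFDerivWithin (m := n) (by norm_cast; omega) hu
  have hB0 : 0 ≤ B := (norm_nonneg _).trans (hB x hx)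
  have key : ∀ a b, segment ℝ a b ⊆ closure Ω →
      ‖iteratedFDerivWithin ℝ n f (closure Ω) a - iteratedFDerivWithin ℝ n f (closure Ω) b‖
        ≤ B * ‖a - b‖ := fun a b hab => by
    refine (convex_segment a b).norm_image_sub_le_of_norm_hasFDerivWithin_le
      (f' := fun z => fderivWithin ℝ (iteratedFDerivWithin ℝ n f (closure Ω)) (closure Ω) z)
      (fun z hz => ((hd z (hab hz)).hasFDerivWithinAt).mono hab) (fun z hz => ?_)
      (right_mem_segment ℝ a b) (left_mem_segment ℝ a b)
    rw [norm_fderivWithin_iteratedFDerivWithin]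
    exact hB z (hab hz)
  set D := iteratedFDerivWithin ℝ n f (closure Ω)
  calc ‖D x - D y‖ = ‖(D x - D p) + (D p - D q) + (D q - D y)‖ := by congr 1; abel
    _ ≤ ‖D x - D p‖ + ‖D p - D q‖ + ‖D q - D y‖ := norm_add₃_le
    _ ≤ B * ‖x - p‖ + B * ‖p - q‖ + B * ‖q - y‖ := by
      gcongr
      · exact key _ _ h1
      · exact key _ _ h2
      · exact key _ _ h3
    _ = B * (‖x - p‖ + ‖p - q‖ + ‖q - y‖) := by ring
    _ ≤ B * (L * ‖x - y‖) := by gcongr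
    _ = L * B * ‖x - y‖ := by ring

end Geometry

section LocalApproximation

variable {E : Type} [NormedAddCommGroup E] [NormedSpace ℝ E]

lemma norm_iteratedFDerivWithin_closure_le {Ω V : Set E} (hΩ : IsOpen Ω) (hV : IsOpen V)
    (hu : UniqueDiffOn ℝ (closure Ω)) {n : ℕ} {h : E → ℝ} (hh : ContDiffOn ℝ n h (closure Ω))
    {i : ℕ} (hi : i ≤ n) {B : ℝ} (hB : ∀ x ∈ Ω ∩ V, ‖iteratedFDeriv ℝ i h x‖ ≤ B) :
    ∀ x ∈ closure Ω ∩ V, ‖iteratedFDerivWithin ℝ i h (closure Ω) x‖ ≤ B := by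
  intro x hx
  have hxc : x ∈ closure (Ω ∩ V) := hV.closure_inter hx
  have hne : (𝓝[Ω ∩ V] x).NeBot := mem_closure_iff_nhdsWithin_neBot.1 hxc
  have hc := ((hh.continuousOn_iteratedFDerivWithin (by exact_mod_cast hi) hu) x hx.1).mono
    (inter_subset_left.trans subset_closure : Ω ∩ V ⊆ closure Ω)
  refine le_of_tendsto hc.norm ?_
  filter_upwards [self_mem_nhdsWithin] with y hy
  rw [iteratedFDerivWithin_closure_of_mem hΩ hy.1]
  exact hB y hy

variable [FiniteDimensional ℝ E]

/-- Functions in `C^t` vanishing on the boundary are locally approximated by smooth functions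
vanishing on the boundary. -/
theorem HasSmoothBoundary.exists_local_approx {Ω : Set E} (hΩ : IsOpen Ω)
    (hb : Bornology.IsBounded Ω) (hs : HasSmoothBoundary Ω) {t : ℝ} (ht : 0 < t) {K : ℕ}
    (hK : K ≠ 0) (htK : ⌊t⌋₊ ≤ K) {x₀ : E} (hx₀ : x₀ ∈ closure Ω) :
    ∃ (V : Set E) (C ε₀ : ℝ), IsOpen V ∧ x₀ ∈ V ∧ 0 ≤ C ∧ 0 < ε₀ ∧ ∀ ε, 0 < ε → ε ≤ ε₀ → ∀ N f,
      0 ≤ N → HolderBound t (closure Ω) f N → (∀ x ∈ frontier Ω, f x = 0) →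
      ∃ G : E → ℝ, ContDiffOn ℝ K G V ∧ (∀ x ∈ frontier Ω ∩ V, G x = 0) ∧ ∀ x ∈ Ω ∩ V,
        (∀ i ≤ ⌊t⌋₊, ‖iteratedFDeriv ℝ i f x - iteratedFDeriv ℝ i G x‖ ≤ C * N * ε ^ (t - i)) ∧
        ∀ i, ⌊t⌋₊ < i → i ≤ K → ‖iteratedFDeriv ℝ i G x‖ ≤ C * N * ε ^ (t - i) := by
  have : CompleteSpace E := FiniteDimensional.complete ℝ E
  have hu := (hs.locallyConical hΩ).uniqueDiffOn
  by_cases hx : x₀ ∈ Ω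
  · obtain ⟨V, ρ, hV, hxV, hVΩ, hρ, hcone⟩ := hΩ.exists_coneProperty hx
    obtain ⟨C, ε₀, hC, hε₀, H⟩ := hcone.exists_approx hΩ hb hρ one_pos ht K
    refine ⟨V, C, ε₀, hV, hxV, hC, hε₀, fun ε hε hεε N f hN hf _ => ?_⟩
    obtain ⟨u, hu, hub⟩ := H ε hε hεε N f hN hf
    refine ⟨u, (hu.of_le (by exact_mod_cast le_top)).contDiffOn, fun x hx => ?_, hub⟩
    rw [hΩ.frontier_eq] at hx
    exact absurd (hVΩ hx.2) hx.1.2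
  obtain ⟨V', V, v, ρ, s₀, D, π, hV', hV, hxV, hVV', hρ, hs₀, hcone, hD, hπ⟩ :=
    hs.exists_coneProperty hΩ (x₀ := x₀) (by rw [hΩ.frontier_eq]; exact ⟨hx₀, hx⟩) hK
  obtain ⟨C, ε₀, hC, hε₀, H⟩ := hcone.exists_approx hΩ hb hρ hs₀ ht K
  refine ⟨V, C + K.factorial * (1 + C) * D ^ K, min ε₀ 1, hV, hxV, by positivity,
    lt_min hε₀ one_pos, fun ε hε hεε N f hN hf hf0 => ?_⟩
  obtain ⟨u, hus, hub⟩ := H ε hε (hεε.trans (min_le_left _ _)) N f hN hf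
  have hε1 : ε ≤ 1 := hεε.trans (min_le_right _ _)
  have huK : ContDiff ℝ K u := hus.of_le (by exact_mod_cast le_top)
  have hπon : ContDiffOn ℝ K π V := fun x hx => (hπ x hx).1.contDiffWithinAt
  have hmaps : MapsTo π V (closure Ω) := fun x hx => (hπ x hx).2.1.2.1
  have huπ : ContDiffOn ℝ K (u ∘ π) V := huK.comp_contDiffOn hπon
  have hmono : ∀ i j : ℕ, j ≤ i → ε ^ (t - j) ≤ ε ^ (t - i) := fun i j hji =>
    Real.rpow_le_rpow_of_exponent_ge hε hε1 (by
      have : (j : ℝ) ≤ i := by exact_mod_cast hji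
      linarith)
  have hconst : ∀ i ≤ K, ∀ r : ℝ, 0 ≤ r → i.factorial * ((1 + C) * N * r) * D ^ i
      ≤ K.factorial * (1 + C) * D ^ K * N * r := fun i hi r hr => by
    have h1 : (i.factorial : ℝ) ≤ K.factorial := by exact_mod_cast Nat.factorial_le hi
    have h2 : D ^ i ≤ D ^ K := pow_le_pow_right₀ hD hi
    calc _ ≤ (K.factorial : ℝ) * ((1 + C) * N * r) * D ^ K := by gcongr
      _ = _ := by ring
  have hcomp : ∀ (g : E → ℝ) (n i : ℕ) (B : ℝ), ContDiffOn ℝ n g (closure Ω) → i ≤ n → i ≤ K →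
      (∀ j ≤ i, ∀ x ∈ Ω ∩ V', ‖iteratedFDeriv ℝ j g x‖ ≤ B) → ∀ x ∈ V,
      ‖iteratedFDeriv ℝ i (g ∘ π) x‖ ≤ i.factorial * B * D ^ i := fun g n i B hg hin hiK hB x hx => by
    rw [← iteratedFDerivWithin_of_isOpen i hV hx]
    refine norm_iteratedFDerivWithin_comp_le (hg.of_le (by exact_mod_cast hin))
      (hπon.of_le (by exact_mod_cast hiK)) le_rfl hu hV.uniqueDiffOn hmaps hx
      (fun j hj => ?_) fun j hj1 hj => ?_
    · exact norm_iteratedFDerivWithin_closure_le hΩ hV' hu hg (hj.trans hin) (hB j hj) _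
        ⟨hmaps hx, (hπ x hx).2.1.1⟩
    · rw [iteratedFDerivWithin_of_isOpen j hV hx]
      exact (hπ x hx).2.2.2 j hj1 (hj.trans hiK)
  refine ⟨u - u ∘ π, huK.contDiffOn.sub huπ, fun x hx => ?_, fun x hx => ?_⟩
  · simp [(hπ x hx.2).2.2.1 hx.1]
  have hsub : ∀ i ≤ K, iteratedFDeriv ℝ i (u - u ∘ π) x
      = iteratedFDeriv ℝ i u x - iteratedFDeriv ℝ i (u ∘ π) x := fun i hi =>
    iteratedFDeriv_sub_apply (huK.contDiffAt.of_le (by exact_mod_cast hi))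
      ((huπ.contDiffAt (hV.mem_nhds hx.2)).of_le (by exact_mod_cast hi))
  refine ⟨fun i hi => ?_, fun i hi hiK => ?_⟩
  · have hiK := hi.trans htK
    have h2 := hcomp (f - u) ⌊t⌋₊ i ((1 + C) * N * ε ^ (t - i))
      (hf.contDiffOn.sub (huK.contDiffOn.of_le (by exact_mod_cast htK))) hi hiK
      (fun j hj y hy => by
        rw [iteratedFDeriv_sub_apply ((hf.contDiffAt hΩ hy.1).of_le (by
          exact_mod_cast hj.trans hi)) (huK.contDiffAt.of_le (by exact_mod_cast hj.trans hiK))]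
        refine ((hub y hy).1 j (hj.trans hi)).trans ?_
        have := hmono i j hj
        gcongr
        linarith) x hx.2
    have h3 : iteratedFDeriv ℝ i (u ∘ π) x = - iteratedFDeriv ℝ i ((f - u) ∘ π) x := by
      rw [← iteratedFDeriv_neg_apply]
      refine Filter.EventuallyEq.eq_of_nhds (Filter.EventuallyEq.iteratedFDeriv ℝ ?_ i)
      filter_upwards [hV.mem_nhds hx.2] with y hy
      simp [hf0 _ (hπ y hy).2.1.2]
    rw [hsub i hiK, h3, sub_neg_eq_add, ← sub_sub]
    refine (norm_sub_le _ _).trans ?_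
    have h1 := (hub x ⟨hx.1, hVV' hx.2⟩).1 i hi
    have h4 := hconst i hiK _ (Real.rpow_nonneg hε.le (t - i))
    linarith
  · have h1 := (hub x ⟨hx.1, hVV' hx.2⟩).2 i hi hiK
    have ht1 : t - i ≤ 0 := by
      have := (Nat.floor_lt ht.le).1 hi
      linarith
    have hone : 1 ≤ ε ^ (t - i) := Real.one_le_rpow_of_pos_of_le_one_of_nonpos hε hε1 ht1
    have h2 := hcomp u K i ((1 + C) * N * ε ^ (t - i)) huK.contDiffOn hiK hiK
      (fun j hj y hy => by
        have hj' := hmono i j hj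
        rcases le_or_gt j ⌊t⌋₊ with hjt | hjt
        · have h5 := (hub y hy).1 j hjt
          have h6 := hf.norm_iteratedFDeriv_le hΩ hjt hy.1
          have h7 := norm_le_norm_add_norm_sub (iteratedFDeriv ℝ j f y) (iteratedFDeriv ℝ j u y)
          have h8 : C * N * ε ^ (t - j) ≤ C * N * ε ^ (t - i) := by gcongr
          have h9 : N ≤ N * ε ^ (t - i) := le_mul_of_one_le_right hN hone
          linarith
        · refine ((hub y hy).2 j hjt (hj.trans hiK)).trans ?_
          gcongr
          linarith) x hx.2
    rw [hsub i hiK]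
    refine (norm_sub_le _ _).trans ?_
    have h4 := hconst i hiK _ (Real.rpow_nonneg hε.le (t - i))
    linarith

end LocalApproximation

section GlobalApproximation

variable {E : Type} [NormedAddCommGroup E] [NormedSpace ℝ E]

lemma norm_iteratedFDeriv_mul_le_of_isOpen {W : Set E} (hW : IsOpen W) {ψ g : E → ℝ} {i : ℕ}
    (hψ : ContDiffOn ℝ i ψ W) (hg : ContDiffOn ℝ i g W) {x : E} (hx : x ∈ W) {A B : ℝ}
    (hA : ∀ l ≤ i, ‖iteratedFDeriv ℝ l ψ x‖ ≤ A) (hB : ∀ l ≤ i, ‖iteratedFDeriv ℝ l g x‖ ≤ B) :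
    ‖iteratedFDeriv ℝ i (fun y => ψ y * g y) x‖ ≤ 2 ^ i * A * B := by
  have hA0 : 0 ≤ A := (norm_nonneg _).trans (hA 0 (Nat.zero_le _))
  rw [← iteratedFDerivWithin_of_isOpen i hW hx]
  refine (norm_iteratedFDerivWithin_mul_le hψ hg hW.uniqueDiffOn hx le_rfl).trans ?_
  have : (2 : ℝ) ^ i = ∑ l ∈ Finset.range (i + 1), (i.choose l : ℝ) := by
    exact_mod_cast (Nat.sum_range_choose i).symm
  rw [this, Finset.sum_mul, Finset.sum_mul]
  refine Finset.sum_le_sum fun l hl => ?_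
  have hl' : l ≤ i := by have := Finset.mem_range.1 hl; omega
  rw [iteratedFDerivWithin_of_isOpen _ hW hx, iteratedFDerivWithin_of_isOpen _ hW hx]
  have h1 := hA l hl'
  have h2 := hB (i - l) (Nat.sub_le _ _)
  gcongr

variable [FiniteDimensional ℝ E]

lemma exists_smooth_partition {s : Set E} (hs : IsClosed s) {ι : Type} [Fintype ι]
    (V : ι → Set E) (hV : ∀ j, IsOpen (V j)) (hsV : s ⊆ ⋃ j, V j) :
    ∃ ψ : ι → E → ℝ, (∀ j, ContDiff ℝ ∞ (ψ j)) ∧ (∀ j, tsupport (ψ j) ⊆ V j) ∧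
      ∀ x ∈ s, ∑ j, ψ j x = 1 := by
  obtain ⟨f, hf⟩ := SmoothPartitionOfUnity.exists_isSubordinate (modelWithCornersSelf ℝ E)
    hs V hV hsV
  refine ⟨fun j => f j, fun j => (f j).contMDiff.contDiff, hf, fun x hx => ?_⟩
  have := f.sum_eq_one hx
  rwa [finsum_eq_sum_of_fintype] at this

/-- Functions in `C^t` vanishing on the boundary are approximated by smoother functions vanishing
on the boundary. -/
theorem HasSmoothBoundary.exists_approx {Ω : Set E} (hΩ : IsOpen Ω)
    (hb : Bornology.IsBounded Ω) (hs : HasSmoothBoundary Ω) {t : ℝ} (ht : 0 < t) {K : ℕ}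
    (hK : K ≠ 0) (htK : ⌊t⌋₊ ≤ K) :
    ∃ C ε₀ : ℝ, 0 ≤ C ∧ 0 < ε₀ ∧ ∀ ε, 0 < ε → ε ≤ ε₀ → ∀ N f,
      0 ≤ N → HolderBound t (closure Ω) f N → (∀ x ∈ frontier Ω, f x = 0) →
      ∃ F : E → ℝ, ContDiff ℝ K F ∧ (∀ x ∈ frontier Ω, F x = 0) ∧ ∀ x ∈ Ω,
        (∀ i ≤ ⌊t⌋₊, ‖iteratedFDeriv ℝ i f x - iteratedFDeriv ℝ i F x‖ ≤ C * N * ε ^ (t - i)) ∧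
        ∀ i, ⌊t⌋₊ < i → i ≤ K → ‖iteratedFDeriv ℝ i F x‖ ≤ C * N * ε ^ (t - i) := by
  have hcpt : IsCompact (closure Ω) := hb.isCompact_closure
  choose! V C ε₀ hV hxV hC hε₀ H using fun x₀ (hx₀ : x₀ ∈ closure Ω) =>
    hs.exists_local_approx hΩ hb ht hK htK hx₀
  obtain ⟨T, hT, hTc⟩ := hcpt.elim_nhds_subcover V fun x hx => (hV x hx).mem_nhds (hxV x hx)
  obtain ⟨ψ, hψ, hψs, hψ1⟩ := exists_smooth_partition isClosed_closure (fun j : T => V j)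
    (fun j => hV j (hT j j.2)) (by simpa [iUnion_subtype] using hTc)
  obtain ⟨C', hC'⟩ := (finite_range fun j : T => C j).bddAbove
  obtain ⟨ε', hε', hε'pos⟩ : ∃ ε' : ℝ, (∀ j : T, ε' ≤ ε₀ j) ∧ 0 < ε' := by
    have h1 : ∀ᶠ ε in 𝓝[>] (0 : ℝ), ∀ j : T, ε ≤ ε₀ j := eventually_all.2 fun j =>
      nhdsWithin_le_nhds (eventually_le_nhds (hε₀ j (hT j j.2)))
    exact (h1.and (self_mem_nhdsWithin (a := (0 : ℝ)) (s := Ioi 0))).exists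
  have hbd : ∀ q : T × Fin (K + 1), ∃ a : ℝ, ∀ x ∈ closure Ω, ‖iteratedFDeriv ℝ q.2 (ψ q.1) x‖ ≤ a :=
    fun q => hcpt.exists_bound_of_continuousOn
      ((hψ q.1).continuous_iteratedFDeriv (by exact_mod_cast le_top)).continuousOn
  choose a ha using hbd
  obtain ⟨A, hA⟩ := (finite_range a).bddAbove
  have hA' : ∀ (j : T) (l : ℕ), l ≤ K → ∀ x ∈ closure Ω, ‖iteratedFDeriv ℝ l (ψ j) x‖ ≤ max A 0 :=
    fun j l hl x hx => (ha (j, ⟨l, by omega⟩) x hx).trans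
      ((hA ⟨_, rfl⟩).trans (le_max_left _ _))
  set A' := max A 0
  set C'' := max C' 0
  have hCj : ∀ j : T, C j ≤ C'' := fun j => (hC' ⟨j, rfl⟩).trans (le_max_left _ _)
  have hA0 : 0 ≤ A' := le_max_right _ _
  have hC0 : 0 ≤ C'' := le_max_right _ _
  refine ⟨Fintype.card T * (2 ^ K * A' * (1 + C'')), min ε' 1, by positivity,
    lt_min hε'pos one_pos, fun ε hε hεε N f hN hf hf0 => ?_⟩
  have hε1 : ε ≤ 1 := hεε.trans (min_le_right _ _)
  choose! G hG hG0 hGb using fun j : T => H j (hT j j.2) ε hε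
    ((hεε.trans (min_le_left _ _)).trans (hε' j)) N f hN hf hf0
  have hψK : ∀ j, ContDiff ℝ K (ψ j) := fun j => (hψ j).of_le (by exact_mod_cast le_top)
  have hsm : ∀ j, ContDiff ℝ K (fun y => ψ j y * G j y) := fun j => contMDiff_iff_contDiff.1
    (contMDiff_of_tsupport fun x hx => by
      have hx' : x ∈ V j := hψs j (tsupport_mul_subset_left hx)
      exact contMDiffAt_iff_contDiffAt.2 ((hψK j).contDiffAt.mul
        ((hG j).contDiffAt ((hV j (hT j j.2)).mem_nhds hx'))))
  have hmono : ∀ i j : ℕ, j ≤ i → ε ^ (t - j) ≤ ε ^ (t - i) := fun i j hji =>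
    Real.rpow_le_rpow_of_exponent_ge hε hε1 (by
      have : (j : ℝ) ≤ i := by exact_mod_cast hji
      linarith)
  have hterm : ∀ (g : E → ℝ) (j : T) (i : ℕ) (x : E), i ≤ K → x ∈ Ω →
      ContDiffOn ℝ i g (Ω ∩ V j) →
      (x ∈ V j → ∀ l ≤ i, ‖iteratedFDeriv ℝ l g x‖ ≤ (1 + C'') * N * ε ^ (t - i)) →
      ‖iteratedFDeriv ℝ i (fun y => ψ j y * g y) x‖
        ≤ 2 ^ K * A' * (1 + C'') * N * ε ^ (t - i) := fun g j i x hiK hx hg hgb => by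
    by_cases hxs : x ∈ tsupport (ψ j)
    · have hxV' := hψs j hxs
      refine (norm_iteratedFDeriv_mul_le_of_isOpen (hΩ.inter (hV j (hT j j.2)))
        ((hψK j).of_le (by exact_mod_cast hiK)).contDiffOn hg ⟨hx, hxV'⟩
        (fun l hl => hA' j l (hl.trans hiK) x (subset_closure hx)) (hgb hxV')).trans ?_
      calc _ ≤ 2 ^ K * A' * ((1 + C'') * N * ε ^ (t - i)) := by
            gcongr
            norm_num
        _ = _ := by ring
    · have : iteratedFDeriv ℝ i (fun y => ψ j y * g y) x = 0 := by
        refine image_eq_zero_of_notMem_tsupport fun h => hxs ?_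
        exact tsupport_mul_subset_left (tsupport_iteratedFDeriv_subset i h)
      rw [this, norm_zero]
      positivity
  have hsum : ∀ (g : T → E → ℝ) (i : ℕ) (x : E),
      (∀ j, ‖iteratedFDeriv ℝ i (g j) x‖ ≤ 2 ^ K * A' * (1 + C'') * N * ε ^ (t - i)) →
      ‖∑ j, iteratedFDeriv ℝ i (g j) x‖
        ≤ Fintype.card T * (2 ^ K * A' * (1 + C'')) * N * ε ^ (t - i) := fun g i x h => by
    refine (norm_sum_le _ _).trans ((Finset.sum_le_sum fun j _ => h j).trans_eq ?_)
    rw [Finset.sum_const, Finset.card_univ, nsmul_eq_mul]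
    ring
  have hGa : ∀ (j : T) (i : ℕ) (x : E), i ≤ K → x ∈ V j → ContDiffAt ℝ i (G j) x :=
    fun j i x hi hx => ((hG j).of_le (by exact_mod_cast hi)).contDiffAt
      ((hV j (hT j j.2)).mem_nhds hx)
  have hfa : ∀ (i : ℕ) (x : E), i ≤ ⌊t⌋₊ → x ∈ Ω → ContDiffAt ℝ i f x := fun i x hi hx =>
    (hf.contDiffAt hΩ hx).of_le (by exact_mod_cast hi)
  refine ⟨fun x => ∑ j, ψ j x * G j x, ContDiff.sum fun j _ => hsm j, fun x hx => ?_,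
    fun x hx => ⟨fun i hi => ?_, fun i hi hiK => ?_⟩⟩
  · refine Finset.sum_eq_zero fun j _ => ?_
    by_cases hxs : x ∈ tsupport (ψ j)
    · rw [hG0 j x ⟨hx, hψs j hxs⟩, mul_zero]
    · rw [image_eq_zero_of_notMem_tsupport hxs, zero_mul]
  · have hiK := hi.trans htK
    have hFi : ContDiffAt ℝ i (fun x => ∑ j, ψ j x * G j x) x :=
      (ContDiff.sum fun j _ => (hsm j).of_le (by exact_mod_cast hiK)).contDiffAt
    have hdiff : iteratedFDeriv ℝ i f x - iteratedFDeriv ℝ i (fun x => ∑ j, ψ j x * G j x) x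
        = ∑ j, iteratedFDeriv ℝ i (fun y => ψ j y * (f - G j) y) x := by
      rw [← iteratedFDeriv_fun_sum_apply, ← iteratedFDeriv_sub_apply (hfa i x hi hx) hFi]
      · refine Filter.EventuallyEq.eq_of_nhds (Filter.EventuallyEq.iteratedFDeriv ℝ ?_ i)
        filter_upwards [hΩ.mem_nhds hx] with y hy
        simp only [Pi.sub_apply, mul_sub, Finset.sum_sub_distrib, ← Finset.sum_mul,
          hψ1 y (subset_closure hy), one_mul]
      · intro j _
        have : (fun y => ψ j y * (f - G j) y) = (fun y => ψ j y * f y) - fun y => ψ j y * G j y := by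
          funext y; simp [mul_sub]
        rw [this]
        exact (((hψK j).of_le (by exact_mod_cast hiK)).contDiffAt.mul (hfa i x hi hx)).sub
          ((hsm j).of_le (by exact_mod_cast hiK)).contDiffAt
    rw [hdiff]
    refine hsum _ i x fun j => hterm _ j i x hiK hx (fun y hy => ?_) fun hxV' l hl => ?_
    · exact ((hfa i y hi hy.1).sub (hGa j i y hiK hy.2)).contDiffWithinAt
    · rw [iteratedFDeriv_sub_apply (hfa l x (hl.trans hi) hx) (hGa j l x (hl.trans hiK) hxV')]
      refine ((hGb j x ⟨hx, hxV'⟩).1 l (hl.trans hi)).trans ?_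
      have h1 := hmono i l hl
      have h2 := hCj j
      gcongr
      linarith
  · rw [iteratedFDeriv_fun_sum_apply fun j _ =>
      ((hsm j).of_le (by exact_mod_cast hiK)).contDiffAt]
    refine hsum _ i x fun j => hterm _ j i x hiK hx (fun y hy => ?_) fun hxV' l hl => ?_
    · exact (hGa j i y hiK hy.2).contDiffWithinAt
    · have h1 := hmono i l hl
      have h2 := hCj j
      have h3 : C j * N * ε ^ (t - l) ≤ C'' * N * ε ^ (t - i) := by gcongr
      have hone : 1 ≤ ε ^ (t - i) := Real.one_le_rpow_of_pos_of_le_one_of_nonpos hε hε1 (by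
        have := (Nat.floor_lt ht.le).1 hi
        linarith)
      have h4 : N ≤ N * ε ^ (t - i) := le_mul_of_one_le_right hN hone
      rcases le_or_gt l ⌊t⌋₊ with hlt | hlt
      · have h5 := (hGb j x ⟨hx, hxV'⟩).1 l hlt
        have h6 := hf.norm_iteratedFDeriv_le hΩ hlt hx
        have h7 := norm_le_norm_add_norm_sub (iteratedFDeriv ℝ l f x) (iteratedFDeriv ℝ l (G j) x)
        linarith
      · have h5 := (hGb j x ⟨hx, hxV'⟩).2 l hlt (hl.trans hiK)
        linarith

end GlobalApproximation

section Decomposition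

lemma rpow_le_rpow_sub_mul_rpow {r ε a b : ℝ} (hr : 0 ≤ r) (hrε : r ≤ ε) (ha : 0 ≤ a)
    (hab : a ≤ b) : r ^ b ≤ ε ^ (b - a) * r ^ a := by
  have h : r ^ b = r ^ (b - a) * r ^ a := by
    rw [← Real.rpow_add_of_nonneg hr (sub_nonneg.2 hab) ha, sub_add_cancel]
  rw [h]
  gcongr

lemma le_rpow_sub_mul_rpow {r ε a : ℝ} (hr : 0 ≤ r) (hrε : r ≤ ε) (ha : 0 ≤ a)
    (ha1 : a ≤ 1) : r ≤ ε ^ (1 - a) * r ^ a := by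
  simpa using rpow_le_rpow_sub_mul_rpow hr hrε ha ha1

variable {E : Type} [NormedAddCommGroup E] [NormedSpace ℝ E]

/-- At scales below `δ`, bounds on a derivative give Lipschitz bounds on the previous one. -/
def LipschitzDerivatives (Ω : Set E) (L δ : ℝ) : Prop :=
  ∀ (f : E → ℝ) (n : ℕ) (B : ℝ), ContDiffOn ℝ (n + 1 : ℕ) f (closure Ω) →
    (∀ x ∈ closure Ω, ‖iteratedFDerivWithin ℝ (n + 1) f (closure Ω) x‖ ≤ B) →
    ∀ x ∈ closure Ω, ∀ y ∈ closure Ω, ‖x - y‖ < δ →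
      ‖iteratedFDerivWithin ℝ n f (closure Ω) x - iteratedFDerivWithin ℝ n f (closure Ω) y‖
        ≤ L * B * ‖x - y‖

variable {Ω : Set E} {L δ t₀ t₁ t₂ ε M N : ℝ} {f : E → ℝ}

lemma LipschitzDerivatives.holderBound_of_lt (hL : LipschitzDerivatives Ω L δ) (hL0 : 0 ≤ L)
    (ht₀ : 0 ≤ t₀) (h₀₁ : t₀ < t₁) (hε : 0 < ε) (hε1 : ε ≤ 1) (hεδ : ε < δ) (hM : 0 ≤ M)
    (hf : ContDiffOn ℝ (⌊t₁⌋₊ : ℕ) f (closure Ω))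
    (hb : ∀ i ≤ ⌊t₁⌋₊, ∀ x ∈ closure Ω,
      ‖iteratedFDerivWithin ℝ i f (closure Ω) x‖ ≤ M * ε ^ (t₁ - i))
    (hh : ∀ x ∈ closure Ω, ∀ y ∈ closure Ω, ‖x - y‖ ≤ ε →
      ‖iteratedFDerivWithin ℝ ⌊t₁⌋₊ f (closure Ω) x
        - iteratedFDerivWithin ℝ ⌊t₁⌋₊ f (closure Ω) y‖ ≤ M * ‖x - y‖ ^ (t₁ - ⌊t₁⌋₊)) :
    HolderBound t₀ (closure Ω) f ((2 + L) * M * ε ^ (t₁ - t₀)) := by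
  have hfl : ⌊t₀⌋₊ ≤ ⌊t₁⌋₊ := Nat.floor_le_floor h₀₁.le
  have hk₀ := Nat.floor_le ht₀
  have hk₀' := Nat.lt_floor_add_one t₀
  have hθ₀ : 0 ≤ t₀ - ⌊t₀⌋₊ := sub_nonneg.2 hk₀
  refine ⟨hf.of_le (by exact_mod_cast hfl), fun i hi x hx => ?_, fun x hx y hy => ?_⟩
  · refine (hb i (hi.trans hfl) x hx).trans ?_
    have h1 : ε ^ (t₁ - i) ≤ ε ^ (t₁ - t₀) := Real.rpow_le_rpow_of_exponent_ge hε hε1 (by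
      have : (i : ℝ) ≤ ⌊t₀⌋₊ := by exact_mod_cast hi
      linarith)
    gcongr
    nlinarith
  · have hr := norm_nonneg (x - y)
    set r := ‖x - y‖
    have hP : 0 ≤ M * ε ^ (t₁ - t₀) * r ^ (t₀ - (⌊t₀⌋₊ : ℝ)) := by positivity
    rcases lt_or_ge ε r with hlt | hle
    · have h1 := hb _ hfl x hx
      have h2 := hb _ hfl y hy
      have h3 : ε ^ (t₁ - (⌊t₀⌋₊ : ℝ)) ≤ ε ^ (t₁ - t₀) * r ^ (t₀ - (⌊t₀⌋₊ : ℝ)) := by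
        rw [show t₁ - (⌊t₀⌋₊ : ℝ) = (t₁ - t₀) + (t₀ - ⌊t₀⌋₊) by ring, Real.rpow_add hε]
        gcongr
      have h4 := mul_le_mul_of_nonneg_left h3 hM
      refine (norm_sub_le _ _).trans ?_
      nlinarith
    rcases hfl.lt_or_eq with hlt | heq
    · have h1 := hL f ⌊t₀⌋₊ _ (hf.of_le (by exact_mod_cast hlt)) (hb _ hlt) x hx y hy
        (hle.trans_lt hεδ)
      have h2 := le_rpow_sub_mul_rpow hr hle hθ₀ (by linarith)
      have h3 : ε ^ (t₁ - ((⌊t₀⌋₊ + 1 : ℕ) : ℝ)) * ε ^ (1 - (t₀ - (⌊t₀⌋₊ : ℝ))) = ε ^ (t₁ - t₀) := by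
        rw [← Real.rpow_add hε]
        congr 1
        push_cast
        ring
      refine h1.trans ?_
      calc L * (M * ε ^ (t₁ - ((⌊t₀⌋₊ + 1 : ℕ) : ℝ))) * r
          ≤ L * (M * ε ^ (t₁ - ((⌊t₀⌋₊ + 1 : ℕ) : ℝ))) *
            (ε ^ (1 - (t₀ - (⌊t₀⌋₊ : ℝ))) * r ^ (t₀ - (⌊t₀⌋₊ : ℝ))) := by gcongr
        _ = L * (M * (ε ^ (t₁ - ((⌊t₀⌋₊ + 1 : ℕ) : ℝ)) * ε ^ (1 - (t₀ - (⌊t₀⌋₊ : ℝ)))) *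
            r ^ (t₀ - (⌊t₀⌋₊ : ℝ))) := by ring
        _ ≤ _ := by rw [h3]; nlinarith
    · have h1 := hh x hx y hy hle
      rw [← heq] at h1
      have h2 := rpow_le_rpow_sub_mul_rpow (b := t₁ - ⌊t₀⌋₊) hr hle hθ₀ (by linarith)
      rw [sub_sub_sub_cancel_right] at h2
      have h4 := mul_le_mul_of_nonneg_left h2 hM
      refine h1.trans (h4.trans ?_)
      nlinarith [mul_nonneg hL0 hP]

lemma LipschitzDerivatives.holderBound_of_gt (hL : LipschitzDerivatives Ω L δ) (hL0 : 0 ≤ L)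
    (ht₁ : 0 ≤ t₁) (h₁₂ : t₁ < t₂) (hε : 0 < ε) (hε1 : ε ≤ 1) (hεδ : ε < δ) (hM : 0 ≤ M)
    (hf : ContDiffOn ℝ (⌊t₂⌋₊ + 1 : ℕ) f (closure Ω))
    (hb : ∀ i ≤ ⌊t₁⌋₊, ∀ x ∈ closure Ω, ‖iteratedFDerivWithin ℝ i f (closure Ω) x‖ ≤ M)
    (hb' : ∀ i, ⌊t₁⌋₊ < i → i ≤ ⌊t₂⌋₊ + 1 → ∀ x ∈ closure Ω,
      ‖iteratedFDerivWithin ℝ i f (closure Ω) x‖ ≤ M * ε ^ (t₁ - i))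
    (hh : ∀ x ∈ closure Ω, ∀ y ∈ closure Ω, ε < ‖x - y‖ →
      ‖iteratedFDerivWithin ℝ ⌊t₁⌋₊ f (closure Ω) x
        - iteratedFDerivWithin ℝ ⌊t₁⌋₊ f (closure Ω) y‖ ≤ M * ‖x - y‖ ^ (t₁ - ⌊t₁⌋₊)) :
    HolderBound t₂ (closure Ω) f ((2 + L) * M * ε ^ (t₁ - t₂)) := by
  have hfl : ⌊t₁⌋₊ ≤ ⌊t₂⌋₊ := Nat.floor_le_floor h₁₂.le
  have hk₂ := Nat.floor_le (ht₁.trans h₁₂.le)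
  have hk₂' := Nat.lt_floor_add_one t₂
  have hθ₂ : 0 ≤ t₂ - ⌊t₂⌋₊ := sub_nonneg.2 hk₂
  have hle2 : M * ε ^ (t₁ - t₂) ≤ (2 + L) * M * ε ^ (t₁ - t₂) := by
    gcongr
    nlinarith
  refine ⟨hf.of_le (by exact_mod_cast Nat.le_succ _), fun i hi x hx => ?_, fun x hx y hy => ?_⟩
  · rcases le_or_gt i ⌊t₁⌋₊ with hi1 | hi1
    · refine (hb i hi1 x hx).trans (le_trans ?_ hle2)
      exact le_mul_of_one_le_right hM
        (Real.one_le_rpow_of_pos_of_le_one_of_nonpos hε hε1 (by linarith))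
    · refine (hb' i hi1 (hi.trans (Nat.le_succ _)) x hx).trans (le_trans ?_ hle2)
      have h1 : ε ^ (t₁ - i) ≤ ε ^ (t₁ - t₂) := Real.rpow_le_rpow_of_exponent_ge hε hε1 (by
        have : (i : ℝ) ≤ ⌊t₂⌋₊ := by exact_mod_cast hi
        linarith)
      gcongr
  · have hr := norm_nonneg (x - y)
    set r := ‖x - y‖
    have hP : 0 ≤ M * ε ^ (t₁ - t₂) * r ^ (t₂ - (⌊t₂⌋₊ : ℝ)) := by positivity
    rcases lt_or_ge ε r with hlt | hle
    · rcases hfl.lt_or_eq with hltf | heq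
      · have h1 := hb' _ hltf (Nat.le_succ _) x hx
        have h2 := hb' _ hltf (Nat.le_succ _) y hy
        have h3 : ε ^ (t₁ - (⌊t₂⌋₊ : ℝ)) ≤ ε ^ (t₁ - t₂) * r ^ (t₂ - (⌊t₂⌋₊ : ℝ)) := by
          rw [show t₁ - (⌊t₂⌋₊ : ℝ) = (t₁ - t₂) + (t₂ - ⌊t₂⌋₊) by ring, Real.rpow_add hε]
          gcongr
        have h4 := mul_le_mul_of_nonneg_left h3 hM
        refine (norm_sub_le _ _).trans ?_
        nlinarith
      · have h1 := hh x hx y hy hlt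
        rw [heq] at h1
        have hr0 : 0 < r := hε.trans hlt
        have h2 : r ^ (t₁ - (⌊t₂⌋₊ : ℝ)) ≤ ε ^ (t₁ - t₂) * r ^ (t₂ - (⌊t₂⌋₊ : ℝ)) := by
          rw [show t₁ - (⌊t₂⌋₊ : ℝ) = (t₁ - t₂) + (t₂ - ⌊t₂⌋₊) by ring, Real.rpow_add hr0]
          have := Real.rpow_le_rpow_of_nonpos hε hlt.le (show t₁ - t₂ ≤ 0 by linarith)
          gcongr
        have h4 := mul_le_mul_of_nonneg_left h2 hM
        refine h1.trans (h4.trans ?_)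
        nlinarith [mul_nonneg hL0 hP]
    · have h1 := hL f ⌊t₂⌋₊ _ hf (hb' _ (Nat.lt_succ_of_le hfl) le_rfl) x hx y hy
        (hle.trans_lt hεδ)
      have h2 := le_rpow_sub_mul_rpow hr hle hθ₂ (by linarith)
      have h3 : ε ^ (t₁ - ((⌊t₂⌋₊ + 1 : ℕ) : ℝ)) * ε ^ (1 - (t₂ - (⌊t₂⌋₊ : ℝ))) = ε ^ (t₁ - t₂) := by
        rw [← Real.rpow_add hε]
        congr 1
        push_cast
        ring
      refine h1.trans ?_
      calc L * (M * ε ^ (t₁ - ((⌊t₂⌋₊ + 1 : ℕ) : ℝ))) * r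
          ≤ L * (M * ε ^ (t₁ - ((⌊t₂⌋₊ + 1 : ℕ) : ℝ))) *
            (ε ^ (1 - (t₂ - (⌊t₂⌋₊ : ℝ))) * r ^ (t₂ - (⌊t₂⌋₊ : ℝ))) := by gcongr
        _ = L * (M * (ε ^ (t₁ - ((⌊t₂⌋₊ + 1 : ℕ) : ℝ)) * ε ^ (1 - (t₂ - (⌊t₂⌋₊ : ℝ)))) *
            r ^ (t₂ - (⌊t₂⌋₊ : ℝ))) := by ring
        _ ≤ _ := by rw [h3]; nlinarith

/-- `C^t` spaces on a conical domain decrease with `t`. -/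
theorem LocallyConical.exists_holderBound_of_lt (h : LocallyConical Ω)
    (hc : IsCompact (closure Ω)) (ht₀ : 0 ≤ t₀) (h₀₁ : t₀ < t₁) :
    ∃ C : ℝ, 0 ≤ C ∧ ∀ N f, 0 ≤ N → HolderBound t₁ (closure Ω) f N →
      HolderBound t₀ (closure Ω) f (C * N) := by
  obtain ⟨L, δ, hL0, hδ, hL⟩ := h.exists_lipschitz hc
  set ε := min (δ / 2) 1
  have hε : 0 < ε := lt_min (by linarith) one_pos
  have hε1 : ε ≤ 1 := min_le_right _ _
  have hεδ : ε < δ := (min_le_left _ _).trans_lt (by linarith)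
  have hge : ∀ i : ℕ, 1 ≤ ε ^ (-t₁) * ε ^ (t₁ - i) := fun i => by
    rw [← Real.rpow_add hε]
    refine Real.one_le_rpow_of_pos_of_le_one_of_nonpos hε hε1 ?_
    have : (0 : ℝ) ≤ i := by positivity
    linarith
  have hge1 : 1 ≤ ε ^ (-t₁) :=
    Real.one_le_rpow_of_pos_of_le_one_of_nonpos hε hε1 (by linarith)
  refine ⟨(2 + L) * ε ^ (-t₁) * ε ^ (t₁ - t₀), by positivity, fun N f hN hf => ?_⟩
  have := LipschitzDerivatives.holderBound_of_lt (M := ε ^ (-t₁) * N) hL hL0 ht₀ h₀₁ hε hε1 hεδ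
    (by positivity) hf.contDiffOn (fun i hi x hx => (hf.norm_le i hi x hx).trans ?_)
    (fun x hx y hy _ => (hf.holder x hx y hy).trans ?_)
  · convert this using 1
    ring
  · have := mul_le_mul_of_nonneg_left (hge i) hN
    linarith
  · have := le_mul_of_one_le_left hN hge1
    gcongr

variable [FiniteDimensional ℝ E]

/-- Quantitative splitting of a `C^{t₁}` function into a small `C^{t₀}` part and a `C^{t₂}` part. -/
theorem HasSmoothBoundary.exists_decomposition (hΩ : IsOpen Ω) (hb : Bornology.IsBounded Ω)
    (hs : HasSmoothBoundary Ω) (ht₀ : 0 ≤ t₀) (h₀₁ : t₀ < t₁) (h₁₂ : t₁ < t₂) :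
    ∃ C ε₀ : ℝ, 0 ≤ C ∧ 0 < ε₀ ∧ ∀ ε, 0 < ε → ε ≤ ε₀ → ∀ N f, 0 ≤ N →
      HolderBound t₁ (closure Ω) f N → (∀ x ∈ frontier Ω, f x = 0) →
      ∃ F : E → ℝ, HolderBound t₀ (closure Ω) (f - F) (C * N * ε ^ (t₁ - t₀)) ∧
        HolderBound t₂ (closure Ω) F (C * N * ε ^ (t₁ - t₂)) ∧ ∀ x ∈ frontier Ω, F x = 0 := by
  have : CompleteSpace E := FiniteDimensional.complete ℝ E
  have hcpt : IsCompact (closure Ω) := hb.isCompact_closure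
  have hcon := hs.locallyConical hΩ
  have hu := hcon.uniqueDiffOn
  have ht₁ : 0 < t₁ := ht₀.trans_lt h₀₁
  have hfl : ⌊t₁⌋₊ ≤ ⌊t₂⌋₊ := Nat.floor_le_floor h₁₂.le
  obtain ⟨L, δ, hL0, hδ, hL⟩ := hcon.exists_lipschitz hcpt
  obtain ⟨C, ε₀, hC, hε₀, H⟩ := hs.exists_approx hΩ hb ht₁ (K := ⌊t₂⌋₊ + 1) (by omega)
    (hfl.trans (Nat.le_succ _))
  have hk₁ := Nat.floor_le ht₁.le
  have hk₁' := Nat.lt_floor_add_one t₁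
  have hθ₁ : 0 ≤ t₁ - ⌊t₁⌋₊ := sub_nonneg.2 hk₁
  refine ⟨(2 + L) * (1 + 2 * C + L * C), min ε₀ (min (δ / 2) 1), by positivity,
    lt_min hε₀ (lt_min (by linarith) one_pos), fun ε hε hεε N f hN hf hf0 => ?_⟩
  obtain ⟨F, hF, hF0, hFb⟩ := H ε hε (hεε.trans (min_le_left _ _)) N f hN hf hf0
  have hε1 : ε ≤ 1 := hεε.trans ((min_le_right _ _).trans (min_le_right _ _))
  have hεδ : ε < δ := (hεε.trans ((min_le_right _ _).trans (min_le_left _ _))).trans_lt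
    (by linarith)
  have hFon : ContDiffOn ℝ (⌊t₂⌋₊ + 1 : ℕ) F (closure Ω) := hF.contDiffOn
  have hFon₁ : ContDiffOn ℝ (⌊t₁⌋₊ : ℕ) F (closure Ω) :=
    hFon.of_le (by exact_mod_cast hfl.trans (Nat.le_succ _))
  have hsubon : ContDiffOn ℝ (⌊t₁⌋₊ : ℕ) (f - F) (closure Ω) := hf.contDiffOn.sub hFon₁
  set D : ∀ (n : ℕ) (g : E → ℝ), E → (E [×n]→L[ℝ] ℝ) :=
    fun n g => iteratedFDerivWithin ℝ n g (closure Ω) with hD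
  have hsub : ∀ i ≤ ⌊t₁⌋₊, ∀ x ∈ closure Ω, D i (f - F) x = D i f x - D i F x :=
    fun i hi x hx => iteratedFDerivWithin_sub_apply
      ((hf.contDiffOn.of_le (by exact_mod_cast hi)) x hx)
      ((hFon₁.of_le (by exact_mod_cast hi)) x hx) hu hx
  have he : ∀ i ≤ ⌊t₁⌋₊, ∀ x ∈ closure Ω, ‖D i (f - F) x‖ ≤ C * N * ε ^ (t₁ - i) :=
    fun i hi x hx => norm_iteratedFDerivWithin_closure_le hΩ isOpen_univ hu
      hsubon hi (fun y hy => by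
        rw [iteratedFDeriv_sub_apply ((hf.contDiffAt hΩ hy.1).of_le (by exact_mod_cast hi))
          (hF.contDiffAt.of_le (by exact_mod_cast (hi.trans hfl).trans (Nat.le_succ _)))]
        exact (hFb y hy.1).1 i hi) x ⟨hx, mem_univ x⟩
  have hFc : ∀ i, ⌊t₁⌋₊ < i → i ≤ ⌊t₂⌋₊ + 1 → ∀ x ∈ closure Ω,
      ‖D i F x‖ ≤ C * N * ε ^ (t₁ - i) := fun i hi hi' x hx =>
    norm_iteratedFDerivWithin_closure_le hΩ isOpen_univ hu hFon hi'
      (fun y hy => (hFb y hy.1).2 i hi hi') x ⟨hx, mem_univ x⟩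
  have hCN : 0 ≤ C * N := by positivity
  have hLCN : 0 ≤ L * C * N := by positivity
  have hCM : C * N ≤ (1 + 2 * C + L * C) * N := by nlinarith
  refine ⟨F, ?_, ?_, hF0⟩
  · have := LipschitzDerivatives.holderBound_of_lt (M := (1 + 2 * C + L * C) * N) hL hL0 ht₀ h₀₁
      hε hε1 hεδ (by positivity) hsubon
      (fun i hi x hx => (he i hi x hx).trans (by gcongr)) (fun x hx y hy hxy => ?_)
    · convert this using 1
      ring
    · have h1 := hf.holder x hx y hy
      have h2 := hL F ⌊t₁⌋₊ _ (hFon.of_le (by exact_mod_cast Nat.succ_le_succ hfl))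
        (hFc _ (Nat.lt_succ_self _) (Nat.succ_le_succ hfl)) x hx y hy (hxy.trans_lt hεδ)
      have h3 := le_rpow_sub_mul_rpow (norm_nonneg (x - y)) hxy hθ₁ (by linarith)
      have h4 : ε ^ (t₁ - ((⌊t₁⌋₊ + 1 : ℕ) : ℝ)) * ε ^ (1 - (t₁ - (⌊t₁⌋₊ : ℝ))) = 1 := by
        rw [← Real.rpow_add hε, show (t₁ - ((⌊t₁⌋₊ + 1 : ℕ) : ℝ)) + (1 - (t₁ - (⌊t₁⌋₊ : ℝ))) = 0 by
          push_cast; ring, Real.rpow_zero]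
      have h5 : L * (C * N * ε ^ (t₁ - ((⌊t₁⌋₊ + 1 : ℕ) : ℝ))) * ‖x - y‖
          ≤ L * C * N * ‖x - y‖ ^ (t₁ - (⌊t₁⌋₊ : ℝ)) := by
        calc _ ≤ L * (C * N * ε ^ (t₁ - ((⌊t₁⌋₊ + 1 : ℕ) : ℝ))) *
              (ε ^ (1 - (t₁ - (⌊t₁⌋₊ : ℝ))) * ‖x - y‖ ^ (t₁ - (⌊t₁⌋₊ : ℝ))) := by gcongr
          _ = L * C * N * (ε ^ (t₁ - ((⌊t₁⌋₊ + 1 : ℕ) : ℝ)) * ε ^ (1 - (t₁ - (⌊t₁⌋₊ : ℝ)))) *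
              ‖x - y‖ ^ (t₁ - (⌊t₁⌋₊ : ℝ)) := by ring
          _ = _ := by rw [h4, mul_one]
      have h6 := hsub _ le_rfl x hx
      have h7 := hsub _ le_rfl y hy
      simp only [hD] at h6 h7
      rw [h6, h7, sub_sub_sub_comm]
      refine (norm_sub_le _ _).trans ?_
      have h8 : 0 ≤ C * N * ‖x - y‖ ^ (t₁ - (⌊t₁⌋₊ : ℝ)) := by positivity
      linarith
  · have := LipschitzDerivatives.holderBound_of_gt (M := (1 + 2 * C + L * C) * N) hL hL0 ht₁.le h₁₂
      hε hε1 hεδ (by positivity) hFon (fun i hi x hx => ?_)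
      (fun i hi hi' x hx => (hFc i hi hi' x hx).trans (by gcongr)) (fun x hx y hy hxy => ?_)
    · convert this using 1
      ring
    · have h1 := he i hi x hx
      rw [hsub i hi x hx] at h1
      have h2 := hf.norm_le i hi x hx
      have h3 := norm_le_norm_add_norm_sub (D i f x) (D i F x)
      have h4 : ε ^ (t₁ - i) ≤ 1 := Real.rpow_le_one hε.le hε1 (by
        have : (i : ℝ) ≤ ⌊t₁⌋₊ := by exact_mod_cast hi
        linarith)
      have h5 := mul_le_of_le_one_right hCN h4
      simp only [hD] at h1 h3 ⊢
      linarith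
    · have h1 := hf.holder x hx y hy
      have h2 := he _ le_rfl x hx
      have h3 := he _ le_rfl y hy
      rw [hsub _ le_rfl x hx] at h2
      rw [hsub _ le_rfl y hy] at h3
      have h4 : C * N * ε ^ (t₁ - (⌊t₁⌋₊ : ℝ)) ≤ C * N * ‖x - y‖ ^ (t₁ - (⌊t₁⌋₊ : ℝ)) := by gcongr
      have h5 : D ⌊t₁⌋₊ F x - D ⌊t₁⌋₊ F y = (D ⌊t₁⌋₊ f x - D ⌊t₁⌋₊ f y)
          - ((D ⌊t₁⌋₊ f x - D ⌊t₁⌋₊ F x) - (D ⌊t₁⌋₊ f y - D ⌊t₁⌋₊ F y)) := by abel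
      have h6 := norm_sub_le (D ⌊t₁⌋₊ f x - D ⌊t₁⌋₊ f y)
        ((D ⌊t₁⌋₊ f x - D ⌊t₁⌋₊ F x) - (D ⌊t₁⌋₊ f y - D ⌊t₁⌋₊ F y))
      have h7 := norm_sub_le (D ⌊t₁⌋₊ f x - D ⌊t₁⌋₊ F x) (D ⌊t₁⌋₊ f y - D ⌊t₁⌋₊ F y)
      rw [← h5] at h6
      have h8 : 0 ≤ L * C * N * ‖x - y‖ ^ (t₁ - (⌊t₁⌋₊ : ℝ)) := by positivity
      simp only [hD] at h2 h3 h6 h7 ⊢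
      linarith

end Decomposition

section Interpolation

/-- Optimizing a two-term bound over the scale `ε` gives a multiplicative bound. -/
lemma exists_interpolation_const {C C₀ ε₀ d θ : ℝ} (hC : 0 ≤ C) (hε₀ : 0 < ε₀) (hd : 0 < d)
    (hθ : θ ∈ Ioo (0 : ℝ) 1) :
    ∃ c > 0, ∀ A B X y : ℝ, 0 ≤ A → 0 ≤ B → 0 ≤ X → B ≤ C₀ * A →
      (∀ ε, 0 < ε → ε ≤ ε₀ →
        y ≤ C * (A * ε ^ ((1 - θ) * d) + B * ε ^ (-(θ * d))) * X) →
      y ≤ c * A ^ θ * B ^ (1 - θ) * X := by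
  obtain ⟨hθ0, hθ1⟩ := hθ
  have hM : (0 : ℝ) < max C₀ 1 := lt_max_of_lt_right one_pos
  set l := ε₀ / (max C₀ 1) ^ (1 / d) with hl
  have hl0 : 0 < l := by positivity
  refine ⟨C * (l ^ ((1 - θ) * d) + l ^ (-(θ * d))) + 1, by positivity,
    fun A B X y hA hB hX hBA H => ?_⟩
  rcases hB.eq_or_lt with rfl | hB
  · have hlim : Tendsto (fun ε : ℝ => C * (A * ε ^ ((1 - θ) * d) + 0 * ε ^ (-(θ * d))) * X)
        (𝓝[>] 0) (𝓝 0) := by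
      have h : Tendsto (fun ε : ℝ => ε ^ ((1 - θ) * d)) (𝓝[>] 0) (𝓝 0) := by
        have hpos : 0 < (1 - θ) * d := mul_pos (sub_pos.2 hθ1) hd
        have := (Real.continuousAt_rpow_const 0 _ (Or.inr hpos.le)).tendsto
        rw [Real.zero_rpow hpos.ne'] at this
        exact this.mono_left nhdsWithin_le_nhds
      simpa using ((h.const_mul A).const_mul C).mul_const X
    rw [Real.zero_rpow (sub_pos.2 hθ1).ne', mul_zero, zero_mul]
    refine ge_of_tendsto hlim ?_
    filter_upwards [Ioc_mem_nhdsGT hε₀] with ε hε using H ε hε.1 hε.2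
  · have hA : 0 < A := hA.lt_of_ne (by rintro rfl; linarith [mul_zero C₀])
    set q := B / A with hq
    have hq0 : 0 < q := div_pos hB hA
    have hqM : q ≤ max C₀ 1 := ((div_le_iff₀ hA).2 hBA).trans (le_max_left _ _)
    have hle : l * q ^ (1 / d) ≤ ε₀ := by
      rw [hl, div_mul_eq_mul_div, div_le_iff₀ (by positivity)]
      gcongr
    refine (H _ (by positivity) hle).trans (mul_le_mul_of_nonneg_right ?_ hX)
    have h1 : (q ^ (1 / d)) ^ ((1 - θ) * d) = q ^ (1 - θ) := by
      rw [← Real.rpow_mul hq0.le]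
      congr 1
      field_simp
    have h2 : (q ^ (1 / d)) ^ (-(θ * d)) = q ^ (-θ) := by
      rw [← Real.rpow_mul hq0.le]
      congr 1
      field_simp
    have h3 : A * q ^ (1 - θ) = A ^ θ * B ^ (1 - θ) := by
      rw [hq, Real.div_rpow hB.le hA.le, Real.rpow_sub hA, Real.rpow_one]
      field_simp
    have h4 : B * q ^ (-θ) = A ^ θ * B ^ (1 - θ) := by
      rw [hq, Real.div_rpow hB.le hA.le, Real.rpow_sub hB, Real.rpow_one, Real.rpow_neg hA.le,
        Real.rpow_neg hB.le]
      field_simp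
    rw [Real.mul_rpow hl0.le (by positivity), Real.mul_rpow hl0.le (by positivity), h1, h2]
    have h5 : 0 ≤ A ^ θ * B ^ (1 - θ) := by positivity
    calc C * (A * (l ^ ((1 - θ) * d) * q ^ (1 - θ)) + B * (l ^ (-(θ * d)) * q ^ (-θ)))
        = C * (l ^ ((1 - θ) * d) * (A * q ^ (1 - θ)) + l ^ (-(θ * d)) * (B * q ^ (-θ))) := by ring
      _ ≤ _ := by
        rw [h3, h4]
        linarith

variable {E : Type} [NormedAddCommGroup E] [NormedSpace ℝ E] {Ω : Set E} {t₀ t₁ t N C : ℝ}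
  {f : E → ℝ} {S : (E → ℝ) → ℝ}

lemma dualNorm_nonneg (t : ℝ) (Ω : Set E) (S : (E → ℝ) → ℝ) : 0 ≤ dualNorm t Ω S :=
  Real.sInf_nonneg fun _ h => h.1

lemma dualNorm_le (hC : 0 ≤ C)
    (h : ∀ f, MemCtTilde t Ω f → |S f| ≤ C * ctNorm t (closure Ω) f) : dualNorm t Ω S ≤ C :=
  csInf_le ⟨0, fun _ h => h.1⟩ ⟨hC, h⟩

lemma abs_le_dualNorm_mul
    (h : ∃ C : ℝ, ∀ f, MemCtTilde t Ω f → |S f| ≤ C * ctNorm t (closure Ω) f)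
    (hf : MemCtTilde t Ω f) : |S f| ≤ dualNorm t Ω S * ctNorm t (closure Ω) f := by
  obtain ⟨C, hC⟩ := h
  rcases (ctNorm_nonneg t (closure Ω) f).eq_or_lt with h0 | hpos
  · simpa [← h0] using hC f hf
  · rw [← div_le_iff₀ hpos]
    refine le_csInf ⟨max C 0, le_max_right _ _, fun g hg => (hC g hg).trans ?_⟩
      fun D hD => (div_le_iff₀ hpos).2 (hD.2 f hf)
    exact mul_le_mul_of_nonneg_right (le_max_left _ _) (ctNorm_nonneg _ _ _)

lemma HolderBound.abs_le (ht : 0 ≤ t) (hf : HolderBound t (closure Ω) f N) (hN : 0 ≤ N)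
    (hf0 : ∀ x ∈ frontier Ω, f x = 0)
    (h : ∃ C : ℝ, ∀ f, MemCtTilde t Ω f → |S f| ≤ C * ctNorm t (closure Ω) f) :
    |S f| ≤ dualNorm t Ω S * N :=
  (abs_le_dualNorm_mul h ⟨hf.memCt ht, hf0⟩).trans
    (mul_le_mul_of_nonneg_left (hf.ctNorm_le ht hN) (dualNorm_nonneg _ _ _))

/-- Boundedness on `C̃^{t₀}` implies boundedness on `C̃^t` for `t > t₀`. -/
lemma LocallyConical.exists_abs_le (hcon : LocallyConical Ω) (hc : IsCompact (closure Ω))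
    (ht₀ : 0 ≤ t₀) (h₀ : t₀ < t) :
    ∃ C : ℝ, 0 ≤ C ∧ ∀ S : (E → ℝ) → ℝ,
      (∃ C : ℝ, ∀ f, MemCtTilde t₀ Ω f → |S f| ≤ C * ctNorm t₀ (closure Ω) f) →
      ∀ f, MemCtTilde t Ω f → |S f| ≤ C * dualNorm t₀ Ω S * ctNorm t (closure Ω) f := by
  obtain ⟨C, hC, H⟩ := hcon.exists_holderBound_of_lt hc ht₀ h₀
  refine ⟨C, hC, fun S hS f hf => ?_⟩
  have hN := ctNorm_nonneg t (closure Ω) f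
  refine ((H _ f hN (hf.1.holderBound (ht₀.trans h₀.le))).abs_le ht₀ (by positivity)
    hf.2 hS).trans_eq ?_
  ring

end Interpolation

end HolderInterpolation

/-- Interpolation inequality for bounded linear functionals: for
`0 ≤ t₀ < t₁ < t₂` and `t₁ = t₊ t₀ + (1 - t₊) t₂`, every bounded linear functional `S` on
`C̃^{t₀}(cl Ω)` restricts to bounded linear functionals on `C̃^{t₁}(cl Ω)` and `C̃^{t₂}(cl Ω)`,
with `‖S|_{C̃^{t₁}}‖ ≤ c ‖S|_{C̃^{t₀}}‖^{t₊} ‖S|_{C̃^{t₂}}‖^{1-t₊}` for `c` independent of `S`. -/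
theorem dual_interpolation (m : ℕ) (Ω : Set (EuclideanSpace ℝ (Fin m)))
    (hΩopen : IsOpen Ω) (hΩbdd : Bornology.IsBounded Ω) (hΩsmooth : HasSmoothBoundary Ω)
    (t₀ t₁ t₂ : ℝ) (ht₀ : 0 ≤ t₀) (h₀₁ : t₀ < t₁) (h₁₂ : t₁ < t₂)
    (tstar : ℝ) (htstar : tstar ∈ Ioo (0:ℝ) 1) (heq : t₁ = tstar * t₀ + (1 - tstar) * t₂) :
    ∃ c > 0, ∀ S : (EuclideanSpace ℝ (Fin m) → ℝ) → ℝ,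
      (∀ f g : EuclideanSpace ℝ (Fin m) → ℝ,
        MemCtTilde t₀ Ω f → MemCtTilde t₀ Ω g → S (f + g) = S f + S g) →
      (∀ (a : ℝ) (f : EuclideanSpace ℝ (Fin m) → ℝ),
        MemCtTilde t₀ Ω f → S (a • f) = a * S f) →
      (∃ C : ℝ, ∀ f : EuclideanSpace ℝ (Fin m) → ℝ,
        MemCtTilde t₀ Ω f → |S f| ≤ C * ctNorm t₀ (closure Ω) f) →
      ((∃ C : ℝ, ∀ f : EuclideanSpace ℝ (Fin m) → ℝ,
          MemCtTilde t₁ Ω f → |S f| ≤ C * ctNorm t₁ (closure Ω) f) ∧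
       (∃ C : ℝ, ∀ f : EuclideanSpace ℝ (Fin m) → ℝ,
          MemCtTilde t₂ Ω f → |S f| ≤ C * ctNorm t₂ (closure Ω) f) ∧
       dualNorm t₁ Ω S ≤ c * dualNorm t₀ Ω S ^ tstar * dualNorm t₂ Ω S ^ (1 - tstar)) := by
  have hcpt : IsCompact (closure Ω) := hΩbdd.isCompact_closure
  have hcon := hΩsmooth.locallyConical hΩopen
  have h₀₂ := h₀₁.trans h₁₂
  have ht₁ : 0 ≤ t₁ := ht₀.trans h₀₁.le
  have ht₂ : 0 ≤ t₂ := ht₁.trans h₁₂.le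
  obtain ⟨C₁, -, H₁⟩ := hcon.exists_abs_le hcpt ht₀ h₀₁
  obtain ⟨C₂, hC₂, H₂⟩ := hcon.exists_abs_le hcpt ht₀ h₀₂
  obtain ⟨C₃, hC₃, H₃⟩ := hcon.exists_holderBound_of_lt hcpt ht₀ h₀₂
  obtain ⟨C, ε₀, hC, hε₀, H⟩ := hΩsmooth.exists_decomposition hΩopen hΩbdd ht₀ h₀₁ h₁₂
  obtain ⟨c, hc, hopt⟩ := exists_interpolation_const (C₀ := C₂) hC hε₀ (sub_pos.2 h₀₂) htstar
  refine ⟨c, hc, fun S hadd _ hS => ⟨⟨_, H₁ S hS⟩, ⟨_, H₂ S hS⟩, ?_⟩⟩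
  have hA := dualNorm_nonneg t₀ Ω S
  have hB := dualNorm_nonneg t₂ Ω S
  refine dualNorm_le (by positivity) fun f hf => ?_
  have hX := ctNorm_nonneg t₁ (closure Ω) f
  refine hopt _ _ _ _ hA hB hX (dualNorm_le (by positivity) (H₂ S hS)) fun ε hε hε' => ?_
  obtain ⟨F, hF₀, hF₂, hF⟩ := H ε hε hε' _ f hX (hf.1.holderBound ht₁) hf.2
  have hfF : ∀ x ∈ frontier Ω, (f - F) x = 0 := fun x hx => by simp [hf.2 x hx, hF x hx]
  have hsplit := hadd (f - F) F ⟨hF₀.memCt ht₀, hfF⟩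
    ⟨(H₃ _ F (by positivity) hF₂).memCt ht₀, hF⟩
  rw [sub_add_cancel] at hsplit
  rw [hsplit, show (1 - tstar) * (t₂ - t₀) = t₁ - t₀ by rw [heq]; ring,
    show -(tstar * (t₂ - t₀)) = t₁ - t₂ by rw [heq]; ring]
  calc |S (f - F) + S F| ≤ |S (f - F)| + |S F| := abs_add_le _ _
    _ ≤ dualNorm t₀ Ω S * (C * ctNorm t₁ (closure Ω) f * ε ^ (t₁ - t₀)) +
        dualNorm t₂ Ω S * (C * ctNorm t₁ (closure Ω) f * ε ^ (t₁ - t₂)) :=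
      add_le_add (hF₀.abs_le ht₀ (by positivity) hfF hS)
        (hF₂.abs_le ht₂ (by positivity) hF ⟨_, H₂ S hS⟩)
    _ = _ := by ring

end
end

section
/- Let β ∈ (1,2). There exists a constant C_β > 0 such that for every nonnegative C² function v on the closed unit disc cl D ⊂ ℂ one has ∫_{∂D} v |dξ| ≤ C_β ( ‖Δv‖_{C̃^{−β}} + ∫_D v dA ), where ∫_{∂D} v |dξ| = ∫_{−π}^{π} v(e^{iθ}) dθ is the integral over the boundary circle and ∫_D v dA the integral over the open disc with respect to Lebesgue measure. -/
open Set Real Complex MeasureTheory intervalIntegral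

noncomputable section

/-- The Laplacian `Δv = ∂²v/∂x² + ∂²v/∂y²` of a function `v : ℂ → ℝ`. -/
def lap (v : ℂ → ℝ) (z : ℂ) : ℝ :=
  fderiv ℝ (fun w => fderiv ℝ v w 1) z 1 +
    fderiv ℝ (fun w => fderiv ℝ v w Complex.I) z Complex.I

/-- The negative norm `‖Δv‖_{C̃^{-β}}`: the supremum of `|∫_D Φ Δv dA|` over `Φ ∈ C^β(cl D)`
vanishing on `∂D` with `‖Φ‖_{C^β(cl D)} ≤ 1`. -/
def lapNegNorm (β : ℝ) (v : ℂ → ℝ) : ℝ :=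
  sSup {r : ℝ | ∃ Φ : ℂ → ℝ, MemCt β (closure (Metric.ball (0 : ℂ) 1)) Φ ∧
    (∀ z ∈ Metric.sphere (0 : ℂ) 1, Φ z = 0) ∧
    ctNorm β (closure (Metric.ball (0 : ℂ) 1)) Φ ≤ 1 ∧
    r = |∫ z in Metric.ball (0 : ℂ) 1, Φ z * lap v z|}

/-- Integration over the unit disc in polar coordinates. -/
lemma setIntegral_ball_eq_polar (g : ℂ → ℝ) :
    ∫ z in Metric.ball (0 : ℂ) 1, g z =
      ∫ p in Ioo (0 : ℝ) 1 ×ˢ Ioo (-π) π, p.1 * g (p.1 * Complex.exp (p.2 * Complex.I)) := by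
  have hm : MeasurableSet (Ioo (0 : ℝ) 1 ×ˢ Ioo (-π) π) := measurableSet_Ioo.prod measurableSet_Ioo
  have hm' : MeasurableSet (Ioi (0 : ℝ) ×ˢ Ioo (-π) π) := measurableSet_Ioi.prod measurableSet_Ioo
  rw [← MeasureTheory.integral_indicator Metric.isOpen_ball.measurableSet,
    ← Complex.integral_comp_polarCoord_symm, polarCoord_target,
    ← MeasureTheory.integral_indicator hm', ← MeasureTheory.integral_indicator hm]
  congr 1
  ext ⟨r, θ⟩
  have he : Complex.polarCoord.symm (r, θ) = r * Complex.exp (θ * Complex.I) := by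
    rw [Complex.polarCoord_symm_apply, Complex.exp_mul_I]
    simp
  by_cases hp : (r, θ) ∈ Ioi (0 : ℝ) ×ˢ Ioo (-π) π
  · rw [indicator_of_mem hp, he]
    simp only [mem_prod, mem_Ioi] at hp
    have hn : ‖(r : ℂ) * Complex.exp (θ * Complex.I)‖ = r := by
      rw [norm_mul, Complex.norm_exp_ofReal_mul_I, mul_one, Complex.norm_real,
        norm_of_nonneg hp.1.le]
    by_cases hr : r < 1
    · rw [indicator_of_mem, indicator_of_mem]
      · rfl
      · exact ⟨⟨hp.1, hr⟩, hp.2⟩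
      · rwa [mem_ball_zero_iff, hn]
    · rw [indicator_of_notMem, indicator_of_notMem, smul_zero]
      · exact fun h => hr h.1.2
      · rwa [mem_ball_zero_iff, hn]
  · rw [indicator_of_notMem hp, indicator_of_notMem]
    exact fun h => hp ⟨h.1.1, h.2⟩

/-- Fubini on an open rectangle, for a function continuous on its closure. -/
lemma setIntegral_rectangle {f : ℝ × ℝ → ℝ} {a b c d : ℝ} (hab : a ≤ b) (hcd : c ≤ d)
    (hf : ContinuousOn f (Icc a b ×ˢ Icc c d)) :
    ∫ p in Ioo a b ×ˢ Ioo c d, f p = ∫ x in a..b, ∫ y in c..d, f (x, y) := by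
  have hi : IntegrableOn f (Ioo a b ×ˢ Ioo c d) :=
    (hf.integrableOn_compact (isCompact_Icc.prod isCompact_Icc)).mono_set
      (prod_mono Ioo_subset_Icc_self Ioo_subset_Icc_self)
  rw [Measure.volume_eq_prod] at hi ⊢
  rw [setIntegral_prod _ hi]
  simp only [intervalIntegral.integral_of_le hab, intervalIntegral.integral_of_le hcd,
    integral_Ioc_eq_integral_Ioo]

/-- Fubini on an open rectangle in the other order, for a function continuous on its closure. -/
lemma setIntegral_rectangle_swap {f : ℝ × ℝ → ℝ} {a b c d : ℝ} (hab : a ≤ b) (hcd : c ≤ d)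
    (hf : ContinuousOn f (Icc a b ×ˢ Icc c d)) :
    ∫ p in Ioo a b ×ˢ Ioo c d, f p = ∫ y in c..d, ∫ x in a..b, f (x, y) := by
  have hf' : ContinuousOn (fun p : ℝ × ℝ => f p.swap) (Icc c d ×ˢ Icc a b) :=
    hf.comp continuous_swap.continuousOn fun p hp => ⟨hp.2, hp.1⟩
  have h := setIntegral_rectangle hcd hab hf'
  rw [Measure.volume_eq_prod, setIntegral_prod_swap] at h
  exact h

lemma hasDerivAt_exp_mul_I (θ : ℝ) :
    HasDerivAt (fun t : ℝ => Complex.exp (t * Complex.I))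
      (Complex.I * Complex.exp (θ * Complex.I)) θ := by
  have h : HasDerivAt (fun t : ℝ => (t : ℂ) * Complex.I) (1 * Complex.I) θ :=
    (Complex.ofRealCLM.hasDerivAt (x := θ)).mul_const Complex.I
  simpa [mul_comm] using h.cexp

section Regularity

variable {v : ℂ → ℝ} {U : Set ℂ}

lemma contDiffOn_one_fderiv (hU : IsOpen U) (hv : ContDiffOn ℝ 2 v U) :
    ContDiffOn ℝ 1 (fderiv ℝ v) U :=
  hv.fderiv_of_isOpen hU (by norm_num)

lemma continuousOn_fderiv_fderiv (hU : IsOpen U) (hv : ContDiffOn ℝ 2 v U) :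
    ContinuousOn (fderiv ℝ (fderiv ℝ v)) U :=
  (contDiffOn_one_fderiv hU hv).continuousOn_fderiv_of_isOpen hU le_rfl

lemma hasFDerivAt_of_contDiffOn_two (hU : IsOpen U) (hv : ContDiffOn ℝ 2 v U) {z : ℂ}
    (hz : z ∈ U) : HasFDerivAt v (fderiv ℝ v z) z :=
  ((hv.differentiableOn (by norm_num)).differentiableAt (hU.mem_nhds hz)).hasFDerivAt

lemma hasFDerivAt_fderiv_of_contDiffOn_two (hU : IsOpen U) (hv : ContDiffOn ℝ 2 v U) {z : ℂ}
    (hz : z ∈ U) : HasFDerivAt (fderiv ℝ v) (fderiv ℝ (fderiv ℝ v) z) z :=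
  (((contDiffOn_one_fderiv hU hv).differentiableOn (by norm_num)).differentiableAt
    (hU.mem_nhds hz)).hasFDerivAt

/-- Differentiating the directional derivative of `v` along a curve. -/
lemma hasDerivAt_fderiv_apply_comp (hU : IsOpen U) (hv : ContDiffOn ℝ 2 v U) {γ w : ℝ → ℂ}
    {γ' w' : ℂ} {t : ℝ} (hγ : HasDerivAt γ γ' t) (hw : HasDerivAt w w' t) (hz : γ t ∈ U) :
    HasDerivAt (fun s => fderiv ℝ v (γ s) (w s))
      (fderiv ℝ (fderiv ℝ v) (γ t) γ' (w t) + fderiv ℝ v (γ t) w') t :=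
  ((hasFDerivAt_fderiv_of_contDiffOn_two hU hv hz).comp_hasDerivAt t hγ).clm_apply hw

lemma lap_eq_fderiv_fderiv (hU : IsOpen U) (hv : ContDiffOn ℝ 2 v U) {z : ℂ} (hz : z ∈ U) :
    lap v z = fderiv ℝ (fderiv ℝ v) z 1 1
      + fderiv ℝ (fderiv ℝ v) z Complex.I Complex.I := by
  have h (a : ℂ) : fderiv ℝ (fun w => fderiv ℝ v w a) z a = fderiv ℝ (fderiv ℝ v) z a a := by
    have := (hasFDerivAt_fderiv_of_contDiffOn_two hU hv hz).clm_apply (hasFDerivAt_const a z)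
    rw [this.fderiv]
    simp
  rw [lap, h, h]

lemma continuousOn_lap (hU : IsOpen U) (hv : ContDiffOn ℝ 2 v U) : ContinuousOn (lap v) U := by
  have h := continuousOn_fderiv_fderiv hU hv
  refine ContinuousOn.congr ?_ fun z hz => lap_eq_fderiv_fderiv hU hv hz
  exact ((h.clm_apply continuousOn_const).clm_apply continuousOn_const).add
    ((h.clm_apply continuousOn_const).clm_apply continuousOn_const)

/-- The Laplacian is the trace of the second derivative in any rotated orthonormal frame. -/
lemma lap_eq_rotated (hU : IsOpen U) (hv : ContDiffOn ℝ 2 v U) {z : ℂ} (hz : z ∈ U) (θ : ℝ) :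
    lap v z =
      fderiv ℝ (fderiv ℝ v) z (Complex.exp (θ * Complex.I)) (Complex.exp (θ * Complex.I))
      + fderiv ℝ (fderiv ℝ v) z (Complex.I * Complex.exp (θ * Complex.I))
          (Complex.I * Complex.exp (θ * Complex.I)) := by
  rw [lap_eq_fderiv_fderiv hU hv hz]
  have h1 : Complex.exp (θ * Complex.I)
      = Real.cos θ • (1 : ℂ) + Real.sin θ • Complex.I := by
    rw [Complex.exp_mul_I]; simp
  have h2 : Complex.I * Complex.exp (θ * Complex.I)
      = -Real.sin θ • (1 : ℂ) + Real.cos θ • Complex.I := by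
    rw [Complex.exp_mul_I]
    simp only [Complex.real_smul, Complex.ofReal_neg, Complex.ofReal_cos, Complex.ofReal_sin]
    linear_combination Complex.sin θ * Complex.I_mul_I
  rw [h2, h1]
  simp only [map_add, map_smul, add_apply, smul_apply,
    smul_eq_mul]
  linear_combination (-(fderiv ℝ (fderiv ℝ v) z 1 1
    + fderiv ℝ (fderiv ℝ v) z Complex.I Complex.I)) * Real.sin_sq_add_cos_sq θ

end Regularity

/-- Green's identity on the unit disc tested against `1 - |z|²`. -/
lemma integral_one_sub_normSq_mul_lap {v : ℂ → ℝ} {U : Set ℂ} (hU : IsOpen U)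
    (hD : Metric.closedBall (0 : ℂ) 1 ⊆ U) (hv : ContDiffOn ℝ 2 v U) :
    ∫ z in Metric.ball (0 : ℂ) 1, ((1 - ‖z‖ ^ 2) * lap v z + 4 * v z)
      = 2 * ∫ θ in (-π)..π, v (Complex.exp (θ * Complex.I)) := by
  set e : ℝ → ℂ := fun θ => Complex.exp (θ * Complex.I) with he
  have hec : Continuous e := by fun_prop
  have hpi : -π ≤ π := by linarith [Real.pi_pos]
  have hn (r θ : ℝ) : ‖(r : ℂ) * e θ‖ = |r| := by
    simp [he, Complex.norm_exp_ofReal_mul_I]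
  have hmem {r : ℝ} (hr : r ∈ Icc (0 : ℝ) 1) (θ : ℝ) : (r : ℂ) * e θ ∈ U := by
    apply hD
    rw [mem_closedBall_zero_iff, hn, abs_of_nonneg hr.1]
    exact hr.2
  set S : Set (ℝ × ℝ) := Icc (0 : ℝ) 1 ×ˢ Icc (-π) π with hS
  have hq : ContinuousOn (fun p : ℝ × ℝ => (p.1 : ℂ) * e p.2) S := by fun_prop
  have hmaps : MapsTo (fun p : ℝ × ℝ => (p.1 : ℂ) * e p.2) S U := fun p hp => hmem hp.1 _
  have hvc : ContinuousOn (fun p : ℝ × ℝ => v (p.1 * e p.2)) S := hv.continuousOn.comp hq hmaps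
  have hd1 : ContinuousOn (fun p : ℝ × ℝ => fderiv ℝ v (p.1 * e p.2)) S :=
    (contDiffOn_one_fderiv hU hv).continuousOn.comp hq hmaps
  have hd2 : ContinuousOn (fun p : ℝ × ℝ => fderiv ℝ (fderiv ℝ v) (p.1 * e p.2)) S :=
    (continuousOn_fderiv_fderiv hU hv).comp hq hmaps
  -- radial part
  set A : ℝ × ℝ → ℝ := fun p => (1 - p.1 ^ 2) * (fderiv ℝ v (p.1 * e p.2) (e p.2)
    + p.1 * fderiv ℝ (fderiv ℝ v) (p.1 * e p.2) (e p.2) (e p.2))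
    + 4 * p.1 * v (p.1 * e p.2) with hA
  -- angular part
  set B : ℝ × ℝ → ℝ := fun p => (1 - p.1 ^ 2) *
    (p.1 * fderiv ℝ (fderiv ℝ v) (p.1 * e p.2) (Complex.I * e p.2) (Complex.I * e p.2)
      - fderiv ℝ v (p.1 * e p.2) (e p.2)) with hB
  have he2 : ContinuousOn (fun p : ℝ × ℝ => e p.2) S := by fun_prop
  have hie2 : ContinuousOn (fun p : ℝ × ℝ => Complex.I * e p.2) S := by fun_prop
  have hAc : ContinuousOn A S := by
    have h1 := hd1.clm_apply he2
    have h2 := (hd2.clm_apply he2).clm_apply he2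
    exact (ContinuousOn.mul (by fun_prop) (h1.add (continuousOn_fst.mul h2))).add
      (ContinuousOn.mul (by fun_prop) hvc)
  have hBc : ContinuousOn B S := by
    have h1 := hd1.clm_apply he2
    have h2 := (hd2.clm_apply hie2).clm_apply hie2
    exact ContinuousOn.mul (by fun_prop) ((continuousOn_fst.mul h2).sub h1)
  have hint {f : ℝ × ℝ → ℝ} (hf : ContinuousOn f S) :
      IntegrableOn f (Ioo (0 : ℝ) 1 ×ˢ Ioo (-π) π) :=
    (hf.integrableOn_compact (isCompact_Icc.prod isCompact_Icc)).mono_set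
      (prod_mono Ioo_subset_Icc_self Ioo_subset_Icc_self)
  have hIA : ∫ p in Ioo (0 : ℝ) 1 ×ˢ Ioo (-π) π, A p = 2 * ∫ θ in (-π)..π, v (e θ) := by
    rw [setIntegral_rectangle_swap zero_le_one hpi hAc, ← intervalIntegral.integral_const_mul]
    refine intervalIntegral.integral_congr fun θ hθ => ?_
    rw [uIcc_of_le hpi] at hθ
    have hc : ContinuousOn (fun r : ℝ => A (r, θ)) (uIcc 0 1) := by
      rw [uIcc_of_le zero_le_one]
      exact hAc.comp (by fun_prop) fun r hr => ⟨hr, hθ⟩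
    have hderiv : ∀ r ∈ uIcc (0 : ℝ) 1, HasDerivAt (fun r : ℝ => (1 - r ^ 2) *
        (r * fderiv ℝ v (r * e θ) (e θ)) + 2 * r ^ 2 * v (r * e θ)) (A (r, θ)) r := by
      intro r hr
      rw [uIcc_of_le zero_le_one] at hr
      have hz := hmem hr θ
      have hp : HasDerivAt (fun r : ℝ => (r : ℂ) * e θ) (e θ) r := by
        simpa using (Complex.ofRealCLM.hasDerivAt (x := r)).mul_const (e θ)
      have h0 := (hasFDerivAt_of_contDiffOn_two hU hv hz).comp_hasDerivAt r hp
      have h1 := hasDerivAt_fderiv_apply_comp hU hv hp (hasDerivAt_const r (e θ)) hz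
      have hsq : HasDerivAt (fun r : ℝ => r ^ 2) (2 * r) r := by
        simpa using hasDerivAt_pow 2 r
      have h2 := ((hsq.const_sub 1).mul ((hasDerivAt_id r).mul h1)).add
        ((hsq.const_mul 2).mul h0)
      refine h2.congr_deriv ?_
      simp only [hA, id_eq, map_zero, add_zero, Function.comp_apply, Pi.mul_apply]
      ring
    rw [intervalIntegral.integral_eq_sub_of_hasDerivAt hderiv hc.intervalIntegrable]
    simp
  have hIB : ∫ p in Ioo (0 : ℝ) 1 ×ˢ Ioo (-π) π, B p = 0 := by
    rw [setIntegral_rectangle zero_le_one hpi hBc]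
    have : EqOn (fun r => ∫ θ in (-π)..π, B (r, θ)) (fun _ => (0 : ℝ)) (uIcc 0 1) := by
      intro r hr
      rw [uIcc_of_le zero_le_one] at hr
      have hc : ContinuousOn (fun θ : ℝ => B (r, θ)) (uIcc (-π) π) := by
        rw [uIcc_of_le hpi]
        exact hBc.comp (by fun_prop) fun θ hθ => ⟨hr, hθ⟩
      have hderiv : ∀ θ ∈ uIcc (-π) π, HasDerivAt (fun θ : ℝ => (1 - r ^ 2) *
          fderiv ℝ v (r * e θ) (Complex.I * e θ)) (B (r, θ)) θ := by
        intro θ _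
        have hz := hmem hr θ
        have hp : HasDerivAt (fun θ : ℝ => (r : ℂ) * e θ) (r * (Complex.I * e θ)) θ :=
          (hasDerivAt_exp_mul_I θ).const_mul _
        have h1 := hasDerivAt_fderiv_apply_comp hU hv hp
          ((hasDerivAt_exp_mul_I θ).const_mul Complex.I) hz
        refine (h1.const_mul (1 - r ^ 2)).congr_deriv ?_
        have hI : Complex.I * (Complex.I * Complex.exp (θ * Complex.I)) = -e θ := by
          rw [← mul_assoc, Complex.I_mul_I, neg_one_mul]
        have hr' : (r : ℂ) * (Complex.I * e θ) = r • (Complex.I * e θ) := by simp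
        rw [hI, hr']
        simp only [hB, map_smul, smul_apply, map_neg,
          smul_eq_mul, he]
        ring
      change ∫ θ in (-π)..π, B (r, θ) = 0
      rw [intervalIntegral.integral_eq_sub_of_hasDerivAt hderiv hc.intervalIntegrable]
      have : e π = e (-π) := by
        simp [he, Complex.exp_neg]
      rw [this, sub_self]
    rw [intervalIntegral.integral_congr this, intervalIntegral.integral_zero]
  have hIAB : ∫ p in Ioo (0 : ℝ) 1 ×ˢ Ioo (-π) π, (A p + B p)
      = 2 * ∫ θ in (-π)..π, v (e θ) := by
    rw [MeasureTheory.integral_add (hint hAc) (hint hBc), hIA, hIB, add_zero]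
  rw [setIntegral_ball_eq_polar, ← hIAB]
  have hm : MeasurableSet (Ioo (0 : ℝ) 1 ×ˢ Ioo (-π) π) := measurableSet_Ioo.prod measurableSet_Ioo
  refine setIntegral_congr_fun hm fun p hp => ?_
  have hr : p.1 ∈ Icc (0 : ℝ) 1 := Ioo_subset_Icc_self hp.1
  have h := lap_eq_rotated hU hv (hmem hr p.2) p.2
  change p.1 * ((1 - ‖(p.1 : ℂ) * e p.2‖ ^ 2) * lap v (p.1 * e p.2) + 4 * v (p.1 * e p.2)) = _
  rw [h, hn, sq_abs]
  simp only [hA, hB, he]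
  ring

section TestFunction

/-- The bound on a test function implied by `ctNorm t s f ≤ 1`. -/
lemma abs_le_one_of_ctNorm_le_one {E : Type*} [NormedAddCommGroup E] [NormedSpace ℝ E]
    {t : ℝ} (ht : 0 ≤ t) {s : Set E} {f : E → ℝ} (hf : MemCt t s f) (h : ctNorm t s f ≤ 1)
    {x : E} (hx : x ∈ s) : |f x| ≤ 1 := by
  obtain ⟨C, hC⟩ := hf.2.1
  refine le_trans (le_csSup ?_ ?_) ((le_max_left _ _).trans h)
  · refine ⟨C, ?_⟩
    rintro r ⟨i, hi, y, hy, rfl⟩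
    exact hC i hi y hy
  · exact ⟨0, by simpa using ht, x, hx, by rw [norm_iteratedFDerivWithin_zero, Real.norm_eq_abs]⟩

/-- The set whose supremum is `lapNegNorm β v` is bounded above if `Δv` is integrable. -/
lemma bddAbove_lapNegNorm {β : ℝ} (hβ : 0 ≤ β) {v : ℂ → ℝ}
    (hv : IntegrableOn (lap v) (Metric.ball (0 : ℂ) 1)) :
    BddAbove {r : ℝ | ∃ Φ : ℂ → ℝ, MemCt β (closure (Metric.ball (0 : ℂ) 1)) Φ ∧
      (∀ z ∈ Metric.sphere (0 : ℂ) 1, Φ z = 0) ∧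
      ctNorm β (closure (Metric.ball (0 : ℂ) 1)) Φ ≤ 1 ∧
      r = |∫ z in Metric.ball (0 : ℂ) 1, Φ z * lap v z|} := by
  refine ⟨∫ z in Metric.ball (0 : ℂ) 1, |lap v z|, ?_⟩
  rintro r ⟨Φ, hΦ, -, hn, rfl⟩
  rw [← Real.norm_eq_abs]
  refine norm_integral_le_of_norm_le hv.abs ?_
  filter_upwards [ae_restrict_mem Metric.isOpen_ball.measurableSet] with z hz
  rw [norm_mul, Real.norm_eq_abs, Real.norm_eq_abs]
  exact mul_le_of_le_one_left (abs_nonneg _)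
    (abs_le_one_of_ctNorm_le_one hβ hΦ hn (subset_closure hz))

lemma hasFDerivAt_one_sub_norm_sq_div (z : ℂ) :
    HasFDerivAt (fun z : ℂ => (1 - ‖z‖ ^ 2) / 4) (-(1 / 2 : ℝ) • innerSL ℝ z) z := by
  have h := ((hasStrictFDerivAt_norm_sq z).hasFDerivAt.const_sub 1).const_mul (1 / 4 : ℝ)
  have h' : HasFDerivAt (fun z : ℂ => (1 - ‖z‖ ^ 2) / 4) _ z :=
    h.congr_of_eventuallyEq (.of_forall fun y => by ring)
  refine h'.congr_fderiv ?_
  ext w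
  simp only [smul_apply, neg_apply, smul_eq_mul]
  ring

lemma uniqueDiffOn_closedBall_complex : UniqueDiffOn ℝ (Metric.closedBall (0 : ℂ) 1) := by
  refine uniqueDiffOn_convex (convex_closedBall _ _) ⟨0, ?_⟩
  exact Metric.ball_subset_interior_closedBall (Metric.mem_ball_self one_pos)

lemma fderivWithin_one_sub_norm_sq_div {z : ℂ} (hz : z ∈ Metric.closedBall (0 : ℂ) 1) :
    fderivWithin ℝ (fun z : ℂ => (1 - ‖z‖ ^ 2) / 4) (Metric.closedBall (0 : ℂ) 1) z
      = -(1 / 2 : ℝ) • innerSL ℝ z :=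
  (hasFDerivAt_one_sub_norm_sq_div z).hasFDerivWithinAt.fderivWithin
    (uniqueDiffOn_closedBall_complex z hz)

lemma norm_iteratedFDerivWithin_one_sub_norm_sq_div_le {i : ℕ} (hi : i < 2) {z : ℂ}
    (hz : z ∈ Metric.closedBall (0 : ℂ) 1) :
    ‖iteratedFDerivWithin ℝ i (fun z : ℂ => (1 - ‖z‖ ^ 2) / 4)
      (Metric.closedBall (0 : ℂ) 1) z‖ ≤ 1 := by
  have hz1 : ‖z‖ ≤ 1 := mem_closedBall_zero_iff.1 hz
  have hz0 := norm_nonneg z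
  interval_cases i
  · rw [norm_iteratedFDerivWithin_zero, Real.norm_eq_abs, abs_le]
    constructor <;> nlinarith
  · rw [norm_iteratedFDerivWithin_one _ (uniqueDiffOn_closedBall_complex z hz),
      fderivWithin_one_sub_norm_sq_div hz, norm_smul, innerSL_apply_norm]
    norm_num
    linarith

lemma norm_iteratedFDerivWithin_one_sub_le {β : ℝ} (hβ : β ∈ Ioo (1 : ℝ) 2) {x y : ℂ}
    (hx : x ∈ Metric.closedBall (0 : ℂ) 1) (hy : y ∈ Metric.closedBall (0 : ℂ) 1) :
    ‖iteratedFDerivWithin ℝ 1 (fun z : ℂ => (1 - ‖z‖ ^ 2) / 4) (Metric.closedBall (0 : ℂ) 1) x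
      - iteratedFDerivWithin ℝ 1 (fun z : ℂ => (1 - ‖z‖ ^ 2) / 4)
        (Metric.closedBall (0 : ℂ) 1) y‖ ≤ ‖x - y‖ ^ (β - 1) := by
  have h1 : ‖iteratedFDerivWithin ℝ 1 (fun z : ℂ => (1 - ‖z‖ ^ 2) / 4)
      (Metric.closedBall (0 : ℂ) 1) x - iteratedFDerivWithin ℝ 1
        (fun z : ℂ => (1 - ‖z‖ ^ 2) / 4) (Metric.closedBall (0 : ℂ) 1) y‖
      ≤ 1 / 2 * ‖x - y‖ := by
    refine ContinuousMultilinearMap.opNorm_le_bound (by positivity) fun m => ?_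
    rw [sub_apply,
      iteratedFDerivWithin_one_apply (uniqueDiffOn_closedBall_complex x hx),
      iteratedFDerivWithin_one_apply (uniqueDiffOn_closedBall_complex y hy),
      fderivWithin_one_sub_norm_sq_div hx, fderivWithin_one_sub_norm_sq_div hy,
      ← sub_apply, ← smul_sub, ← map_sub]
    refine (ContinuousLinearMap.le_opNorm _ _).trans_eq ?_
    rw [norm_smul, innerSL_apply_norm]
    simp
  refine h1.trans ?_
  have hd : ‖x - y‖ / 2 ≤ 1 := by
    have := norm_sub_le x y
    linarith [mem_closedBall_zero_iff.1 hx, mem_closedBall_zero_iff.1 hy]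
  have hd0 : 0 ≤ ‖x - y‖ / 2 := by positivity
  calc 1 / 2 * ‖x - y‖ = (‖x - y‖ / 2) ^ (1 : ℝ) := by rw [Real.rpow_one]; ring
    _ ≤ (‖x - y‖ / 2) ^ (β - 1) :=
      Real.rpow_le_rpow_of_exponent_ge' hd0 hd (by linarith [hβ.1]) (by linarith [hβ.2])
    _ ≤ ‖x - y‖ ^ (β - 1) :=
      Real.rpow_le_rpow hd0 (by linarith) (by linarith [hβ.1])

lemma floor_eq_one_of_mem_Ioo {β : ℝ} (hβ : β ∈ Ioo (1 : ℝ) 2) : ⌊β⌋₊ = 1 := by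
  rw [Nat.floor_eq_iff (by linarith [hβ.1])]
  exact ⟨by simpa using hβ.1.le, by norm_num; exact hβ.2⟩

lemma lt_two_of_cast_le {β : ℝ} (hβ : β ∈ Ioo (1 : ℝ) 2) {i : ℕ} (hi : (i : ℝ) ≤ β) : i < 2 := by
  exact_mod_cast hi.trans_lt hβ.2

lemma memCt_one_sub_norm_sq_div {β : ℝ} (hβ : β ∈ Ioo (1 : ℝ) 2) :
    MemCt β (Metric.closedBall (0 : ℂ) 1) (fun z : ℂ => (1 - ‖z‖ ^ 2) / 4) := by
  refine ⟨((contDiff_const.sub (contDiff_norm_sq ℝ)).div_const 4).contDiffOn, ⟨1, ?_⟩, ⟨1, ?_⟩⟩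
  · exact fun i hi x hx =>
      norm_iteratedFDerivWithin_one_sub_norm_sq_div_le (lt_two_of_cast_le hβ hi) hx
  · intro x hx y hy
    rw [floor_eq_one_of_mem_Ioo hβ, one_mul, Nat.cast_one]
    exact norm_iteratedFDerivWithin_one_sub_le hβ hx hy

lemma ctNorm_one_sub_norm_sq_div_le {β : ℝ} (hβ : β ∈ Ioo (1 : ℝ) 2) :
    ctNorm β (Metric.closedBall (0 : ℂ) 1) (fun z : ℂ => (1 - ‖z‖ ^ 2) / 4) ≤ 1 := by
  refine max_le (Real.sSup_le ?_ zero_le_one) (Real.sSup_le ?_ zero_le_one)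
  · rintro r ⟨i, hi, x, hx, rfl⟩
    exact norm_iteratedFDerivWithin_one_sub_norm_sq_div_le (lt_two_of_cast_le hβ hi) hx
  · rintro r ⟨x, hx, y, hy, -, rfl⟩
    rw [floor_eq_one_of_mem_Ioo hβ, Nat.cast_one]
    exact div_le_one_of_le₀ (norm_iteratedFDerivWithin_one_sub_le hβ hx hy) (by positivity)

end TestFunction

/-- For `β ∈ (1,2)` there is `C_β > 0` such that for every nonnegative `C²`
function `v` on the closed unit disc,
`∫_{∂D} v |dξ| ≤ C_β (‖Δv‖_{C̃^{-β}} + ∫_D v dA)`. -/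
theorem boundary_integral_le (β : ℝ) (hβ : β ∈ Ioo (1 : ℝ) 2) :
    ∃ C > 0, ∀ (v : ℂ → ℝ) (U : Set ℂ), IsOpen U → closure (Metric.ball (0 : ℂ) 1) ⊆ U →
      ContDiffOn ℝ 2 v U → (∀ z ∈ closure (Metric.ball (0 : ℂ) 1), 0 ≤ v z) →
      (∫ θ in (-π)..π, v (Complex.exp (θ * Complex.I)))
        ≤ C * (lapNegNorm β v + ∫ z in Metric.ball (0 : ℂ) 1, v z) := by
  refine ⟨2, two_pos, fun v U hU hD hv _ => ?_⟩
  have hcl : closure (Metric.ball (0 : ℂ) 1) = Metric.closedBall 0 1 :=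
    closure_ball _ one_ne_zero
  rw [hcl] at hD
  have hint {f : ℂ → ℝ} (hf : ContinuousOn f U) : IntegrableOn f (Metric.ball (0 : ℂ) 1) :=
    ((hf.mono hD).integrableOn_compact (isCompact_closedBall _ _)).mono_set
      Metric.ball_subset_closedBall
  have hlap := continuousOn_lap hU hv
  have hle : |∫ z in Metric.ball (0 : ℂ) 1, (1 - ‖z‖ ^ 2) / 4 * lap v z| ≤ lapNegNorm β v := by
    refine le_csSup (bddAbove_lapNegNorm (by linarith [hβ.1]) (hint hlap))
      ⟨fun z => (1 - ‖z‖ ^ 2) / 4, ?_, ?_, ?_, rfl⟩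
    · rw [hcl]
      exact memCt_one_sub_norm_sq_div hβ
    · intro z hz
      simp [mem_sphere_zero_iff_norm.1 hz]
    · rw [hcl]
      exact ctNorm_one_sub_norm_sq_div_le hβ
  have hgreen := integral_one_sub_normSq_mul_lap hU hD hv
  have heq : ∫ z in Metric.ball (0 : ℂ) 1, (1 - ‖z‖ ^ 2) * lap v z
      = 4 * ∫ z in Metric.ball (0 : ℂ) 1, (1 - ‖z‖ ^ 2) / 4 * lap v z := by
    rw [← MeasureTheory.integral_const_mul]
    exact integral_congr_ae (.of_forall fun z => by ring)
  have h1 : ContinuousOn (fun z : ℂ => (1 - ‖z‖ ^ 2) * lap v z) U :=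
    ContinuousOn.mul (by fun_prop) hlap
  rw [integral_add (hint h1) ((hint hv.continuousOn).const_mul 4),
    MeasureTheory.integral_const_mul, heq] at hgreen
  linarith [le_abs_self (∫ z in Metric.ball (0 : ℂ) 1, (1 - ‖z‖ ^ 2) / 4 * lap v z)]

end
end
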